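/- (Corollary 3.1(ii).) If an approximate design P is φ1-universally optimal, then C(P) = n y* B_t/(t−1). -/

import Mathlib

open Matrix Finset

noncomputable section

/-- `B^m_{i,j}`: the `i × j` real matrix whose upper-left `m × m` block is
`B_m = I_m − J_m/m` and whose remaining entries are `0`. -/
def Bblock (m i j : ℕ) : Matrix (Fin i) (Fin j) ℝ :=
  Matrix.of fun a b =>
    if (a : ℕ) < m ∧ (b : ℕ) < m then
      (if (a : ℕ) = (b : ℕ) then 1 else 0) - 1 / (m : ℝ)
    else 0

/-- `B_k = I_k − J_k/k`. -/
def Bsq (k : ℕ) : Matrix (Fin k) (Fin k) ℝ := Bblock k k k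

/-- Partial sums `a_{j,k} = ∑_{i=j}^k a_i`. -/
def aInt (a : ℕ → ℝ) (j k : ℕ) : ℝ := ∑ i ∈ Finset.Icc j k, a i

/-- `α_k = n⁻¹((n+1)a_k + a_{1,k−1}^{n+1} − a_{1,k}^{n+1})`. -/
def alphaCoef (n : ℕ) (a : ℕ → ℝ) (k : ℕ) : ℝ :=
  (((n : ℝ) + 1) * a k + (aInt a 1 (k - 1)) ^ (n + 1) - (aInt a 1 k) ^ (n + 1)) / (n : ℝ)

/-- `β_k = a_k + a_{k+1,p} a_{1,k}^n − a_{k,p} a_{1,k−1}^n`. -/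
def betaCoef (p n : ℕ) (a : ℕ → ℝ) (k : ℕ) : ℝ :=
  a k + aInt a (k + 1) p * (aInt a 1 k) ^ n - aInt a k p * (aInt a 1 (k - 1)) ^ n

/-- `A = ∑_{k=1}^p α_k B^k_p`. -/
def Amat (p n : ℕ) (a : ℕ → ℝ) : Matrix (Fin p) (Fin p) ℝ :=
  ∑ k ∈ Finset.Icc 1 p, alphaCoef n a k • Bblock k p p

/-- `B = ∑_{k=1}^p β_k B^k_p`. -/
def Bmat (p n : ℕ) (a : ℕ → ℝ) : Matrix (Fin p) (Fin p) ℝ :=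
  ∑ k ∈ Finset.Icc 1 p, betaCoef p n a k • Bblock k p p


/-- Treatment/period incidence matrix `T_s` of a treatment sequence `s`
(periods are indexed by `Fin p`, treatments by `Fin t`). -/
def Tmat {p t : ℕ} (s : Fin p → Fin t) : Matrix (Fin p) (Fin t) ℝ :=
  Matrix.of fun k i => if s k = i then 1 else 0

/-- Carryover incidence matrix `F_s`: `(F_s)_{k,i} = 1` iff `k ≥ 2` and the
treatment in period `k − 1` is `i`. -/
def Fmat {p t : ℕ} (s : Fin p → Fin t) : Matrix (Fin p) (Fin t) ℝ :=
  Matrix.of fun k i =>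
    if (k : ℕ) = 0 then 0
    else if s ⟨(k : ℕ) - 1, lt_of_le_of_lt (Nat.sub_le _ _) k.isLt⟩ = i then 1 else 0

/-- `T̂_s = T_s B_t`. -/
def That {p t : ℕ} (s : Fin p → Fin t) : Matrix (Fin p) (Fin t) ℝ := Tmat s * Bsq t

/-- `F̂_s = F_s B_t`. -/
def Fhat {p t : ℕ} (s : Fin p → Fin t) : Matrix (Fin p) (Fin t) ℝ := Fmat s * Bsq t

/-- An approximate design: a probability vector indexed by all `t^p` sequences. -/
def IsDesign {p t : ℕ} (P : (Fin p → Fin t) → ℝ) : Prop :=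
  (∀ s, 0 ≤ P s) ∧ ∑ s, P s = 1

/-- A design is symmetric if it is invariant under relabeling of treatments. -/
def IsSymmetricDesign {p t : ℕ} (P : (Fin p → Fin t) → ℝ) : Prop :=
  ∀ (σ : Equiv.Perm (Fin t)) (s : Fin p → Fin t), P (fun k => σ (s k)) = P s

/-- `T̄ = ∑_s p_s T_s`. -/
def Tbar {p t : ℕ} (P : (Fin p → Fin t) → ℝ) : Matrix (Fin p) (Fin t) ℝ :=
  ∑ s, P s • Tmat s

/-- `F̄ = ∑_s p_s F_s`. -/
def Fbar {p t : ℕ} (P : (Fin p → Fin t) → ℝ) : Matrix (Fin p) (Fin t) ℝ :=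
  ∑ s, P s • Fmat s

/-- `C₁₁(P) = n(∑_s p_s T_s' A T_s − T̄' B T̄)`. -/
def C11 (p t n : ℕ) (a : ℕ → ℝ) (P : (Fin p → Fin t) → ℝ) : Matrix (Fin t) (Fin t) ℝ :=
  (n : ℝ) • (∑ s, P s • ((Tmat s)ᵀ * Amat p n a * Tmat s) - (Tbar P)ᵀ * Bmat p n a * Tbar P)

/-- `C₁₂(P) = n(∑_s p_s T_s' A F_s − T̄' B F̄)`. -/
def C12 (p t n : ℕ) (a : ℕ → ℝ) (P : (Fin p → Fin t) → ℝ) : Matrix (Fin t) (Fin t) ℝ :=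
  (n : ℝ) • (∑ s, P s • ((Tmat s)ᵀ * Amat p n a * Fmat s) - (Tbar P)ᵀ * Bmat p n a * Fbar P)

/-- `C₂₂(P) = n(∑_s p_s F_s' A F_s − F̄' B F̄)`. -/
def C22 (p t n : ℕ) (a : ℕ → ℝ) (P : (Fin p → Fin t) → ℝ) : Matrix (Fin t) (Fin t) ℝ :=
  (n : ℝ) • (∑ s, P s • ((Fmat s)ᵀ * Amat p n a * Fmat s) - (Fbar P)ᵀ * Bmat p n a * Fbar P)

/-- `W` is a generalized inverse of `C`. -/
def IsGInv {t : ℕ} (C W : Matrix (Fin t) (Fin t) ℝ) : Prop := C * W * C = C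

/-- The information matrix `C(P) = C₁₁(P) − C₁₂(P) W C₂₁(P)`, computed with a
generalized inverse `W` of `C₂₂(P)` (its value does not depend on the choice). -/
def CInfo (p t n : ℕ) (a : ℕ → ℝ) (P : (Fin p → Fin t) → ℝ)
    (W : Matrix (Fin t) (Fin t) ℝ) : Matrix (Fin t) (Fin t) ℝ :=
  C11 p t n a P - C12 p t n a P * W * (C12 p t n a P)ᵀ

/-- The `t × t` permutation matrix of a permutation `σ` of the treatments. -/
def permMat (t : ℕ) (σ : Equiv.Perm (Fin t)) : Matrix (Fin t) (Fin t) ℝ :=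
  Matrix.of fun i j => if σ j = i then 1 else 0

/-- An optimality criterion: a real-valued function `Φ` on `t × t` real symmetric
matrices which is (C.1) concave, (C.2) invariant under simultaneous permutation of
rows and columns, and (C.3) nondecreasing under positive scaling of a positive
semidefinite matrix. -/
def IsCriterion (t : ℕ) (Φ : Matrix (Fin t) (Fin t) ℝ → ℝ) : Prop :=
  (∀ lam : ℝ, 0 ≤ lam → lam ≤ 1 → ∀ M N : Matrix (Fin t) (Fin t) ℝ,
      M.IsHermitian → N.IsHermitian →
      lam * Φ M + (1 - lam) * Φ N ≤ Φ (lam • M + (1 - lam) • N)) ∧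
  (∀ (σ : Equiv.Perm (Fin t)) (M : Matrix (Fin t) (Fin t) ℝ),
      Φ ((permMat t σ)ᵀ * M * permMat t σ) = Φ M) ∧
  (∀ M : Matrix (Fin t) (Fin t) ℝ, M.PosSemidef →
      ∀ b c : ℝ, 0 < b → b ≤ c → Φ (b • M) ≤ Φ (c • M))

/-- `P` is φ₁-universally optimal: `Φ(C(P)) ≥ Φ(C(Q))` for every design `Q` and
every optimality criterion `Φ`. -/
def IsUnivOptimal (p t n : ℕ) (a : ℕ → ℝ) (P : (Fin p → Fin t) → ℝ) : Prop :=
  ∀ Φ : Matrix (Fin t) (Fin t) ℝ → ℝ, IsCriterion t Φ →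
    ∀ Q : (Fin p → Fin t) → ℝ, IsDesign Q →
      ∀ WP WQ : Matrix (Fin t) (Fin t) ℝ,
        IsGInv (C22 p t n a P) WP → IsGInv (C22 p t n a Q) WQ →
          Φ (CInfo p t n a Q WQ) ≤ Φ (CInfo p t n a P WP)

/-- `q_{s,11} = tr(B_t T_s' A T_s B_t)`. -/
def q11 (p t n : ℕ) (a : ℕ → ℝ) (s : Fin p → Fin t) : ℝ :=
  (Bsq t * (Tmat s)ᵀ * Amat p n a * Tmat s * Bsq t).trace

/-- `q_{s,12} = tr(B_t T_s' A F_s B_t)`. -/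
def q12 (p t n : ℕ) (a : ℕ → ℝ) (s : Fin p → Fin t) : ℝ :=
  (Bsq t * (Tmat s)ᵀ * Amat p n a * Fmat s * Bsq t).trace

/-- `q_{s,22} = tr(B_t F_s' A F_s B_t)`. -/
def q22 (p t n : ℕ) (a : ℕ → ℝ) (s : Fin p → Fin t) : ℝ :=
  (Bsq t * (Fmat s)ᵀ * Amat p n a * Fmat s * Bsq t).trace

/-- The quadratic `q_s(x) = q_{s,11} + 2 q_{s,12} x + q_{s,22} x²`. -/
def qfun (p t n : ℕ) (a : ℕ → ℝ) (s : Fin p → Fin t) (x : ℝ) : ℝ :=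
  q11 p t n a s + 2 * q12 p t n a s * x + q22 p t n a s * x ^ 2

/-- `min_x ∑_s p_s q_s(x)`. -/
def qmin (p t n : ℕ) (a : ℕ → ℝ) (P : (Fin p → Fin t) → ℝ) : ℝ :=
  sInf (Set.range fun x : ℝ => ∑ s, P s * qfun p t n a s x)

/-- `y* = max_P min_x ∑_s p_s q_s(x)`, the maximum over all approximate designs. -/
def ystar (p t n : ℕ) (a : ℕ → ℝ) : ℝ :=
  sSup {y : ℝ | ∃ P : (Fin p → Fin t) → ℝ, IsDesign P ∧ y = qmin p t n a P}

section

theorem Bblock_transpose (m k : ℕ) : (Bblock m k k)ᵀ = Bblock m k k := by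
  ext i j
  simp only [Bblock, transpose_apply, of_apply]
  simp only [and_comm, eq_comm]

theorem Bblock_mulVec {p : ℕ} (m : ℕ) (f : Fin p → ℝ) (i : Fin p) :
    (Bblock m p p *ᵥ f) i =
      if (i : ℕ) < m then f i - (∑ j : Fin p, if (j : ℕ) < m then f j else 0) / m else 0 := by
  simp only [Bblock, mulVec, dotProduct, of_apply]
  by_cases h : (i : ℕ) < m
  · simp only [h, true_and, if_true]
    have : ∀ j : Fin p,
        (if (j : ℕ) < m then (if (i : ℕ) = (j : ℕ) then (1 : ℝ) else 0) - 1 / m else 0) * f j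
        = (if i = j then f j else 0) - (if (j : ℕ) < m then f j else 0) / m := by
      intro j
      by_cases hij : i = j
      · subst hij; simp [h]; ring
      · have : (i : ℕ) ≠ j := fun e => hij (Fin.ext e)
        by_cases hj : (j : ℕ) < m
        · simp [hij, this, hj]; ring
        · simp [hij, hj]
    rw [Finset.sum_congr rfl fun j _ => this j, Finset.sum_sub_distrib, Finset.sum_div]
    simp
  · simp [h]

theorem sum_ite_lt_one {p m : ℕ} (hm : m ≤ p) :
    (∑ j : Fin p, if (j : ℕ) < m then (1 : ℝ) else 0) = m := by
  rw [Fin.sum_univ_eq_sum_range (fun j => if j < m then (1 : ℝ) else 0) p, Finset.sum_ite]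
  have : (Finset.range p).filter (· < m) = Finset.range m := by
    ext x; simp; omega
  simp [this]

theorem Bblock_mulVec_one {p m : ℕ} (hm : m ≤ p) : Bblock m p p *ᵥ (1 : Fin p → ℝ) = 0 := by
  ext i
  rw [Bblock_mulVec]
  simp only [Pi.one_apply, sum_ite_lt_one hm, Pi.zero_apply]
  split_ifs with h
  · have : (m : ℝ) ≠ 0 := by exact_mod_cast (by omega : m ≠ 0)
    field_simp; simp
  · rfl

theorem dotProduct_Bblock_mulVec {p : ℕ} (m : ℕ) (f : Fin p → ℝ) :
    f ⬝ᵥ (Bblock m p p *ᵥ f) =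
      (∑ j : Fin p, if (j : ℕ) < m then f j ^ 2 else 0) -
        (∑ j : Fin p, if (j : ℕ) < m then f j else 0) ^ 2 / m := by
  simp only [dotProduct, Bblock_mulVec]
  set S := ∑ j : Fin p, if (j : ℕ) < m then f j else 0 with hS
  have : ∀ j : Fin p, f j * (if (j : ℕ) < m then f j - S / m else 0) =
      (if (j : ℕ) < m then f j ^ 2 else 0) - (if (j : ℕ) < m then f j else 0) * (S / m) := by
    intro j; split_ifs <;> ring
  rw [Finset.sum_congr rfl fun j _ => this j, Finset.sum_sub_distrib, ← Finset.sum_mul, ← hS]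
  ring

theorem sum_ite_lt_succ {p : ℕ} (g : Fin p → ℝ) {k : ℕ} (hk : k < p) :
    (∑ j : Fin p, if (j : ℕ) < k + 1 then g j else 0) =
      (∑ j : Fin p, if (j : ℕ) < k then g j else 0) + g ⟨k, hk⟩ := by
  have : ∀ j : Fin p, (if (j : ℕ) < k + 1 then g j else 0) =
      (if (j : ℕ) < k then g j else 0) + if ⟨k, hk⟩ = j then g j else 0 := by
    intro j
    have : (⟨k, hk⟩ : Fin p) = j ↔ k = (j : ℕ) := by rw [Fin.ext_iff]
    simp only [this]
    rcases lt_trichotomy (j : ℕ) k with h | h | h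
    · simp [h, Nat.lt_succ_of_lt h, h.ne']
    · simp [h]
    · simp [h.ne, not_lt.2 h.le, show ¬ (j : ℕ) < k + 1 by omega]
  rw [Finset.sum_congr rfl fun j _ => this j, Finset.sum_add_distrib]
  simp

theorem dotProduct_Bblock_mono {p k : ℕ} (hk : k < p) (f : Fin p → ℝ) :
    f ⬝ᵥ (Bblock k p p *ᵥ f) ≤ f ⬝ᵥ (Bblock (k + 1) p p *ᵥ f) := by
  rw [dotProduct_Bblock_mulVec, dotProduct_Bblock_mulVec, sum_ite_lt_succ _ hk,
    sum_ite_lt_succ _ hk]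
  set S := ∑ j : Fin p, if (j : ℕ) < k then f j else 0 with hS
  set y := f ⟨k, hk⟩
  rcases Nat.eq_zero_or_pos k with rfl | h
  · simp [hS]
  · have hk' : (0 : ℝ) < k := by exact_mod_cast h
    have : y ^ 2 - (S + y) ^ 2 / ((k + 1 : ℕ) : ℝ) + S ^ 2 / k =
        (k * y - S) ^ 2 / (k * (k + 1)) := by
      push_cast; field_simp; ring
    have h2 : 0 ≤ (k * y - S) ^ 2 / (k * (k + 1)) := by positivity
    linarith

/-- Abel summation against the increments of `G`. -/
theorem sum_Icc_sub_mul (G b : ℕ → ℝ) (hb : b 0 = 0) (m : ℕ) :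
    ∑ k ∈ Icc 1 m, (G k - G (k - 1)) * b k =
      ∑ k ∈ Icc 1 m, (G m - G (k - 1)) * (b k - b (k - 1)) := by
  induction m with
  | zero => simp
  | succ m ih =>
    have tel : ∑ k ∈ Icc 1 m, (b k - b (k - 1)) = b m := by
      clear ih
      induction m with
      | zero => simp [hb]
      | succ m ih => rw [Finset.sum_Icc_succ_top (by omega), ih]; simp
    have h : ∑ k ∈ Icc 1 m, (G (m + 1) - G (k - 1)) * (b k - b (k - 1)) =
        ∑ k ∈ Icc 1 m, (G m - G (k - 1)) * (b k - b (k - 1)) + (G (m + 1) - G m) * b m := by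
      rw [← tel, Finset.mul_sum, ← Finset.sum_add_distrib]
      exact Finset.sum_congr rfl fun _ _ => by ring
    rw [Finset.sum_Icc_succ_top (by omega), Finset.sum_Icc_succ_top (by omega), h, ih]
    simp; ring

theorem sum_smul_Bblock_mulVec_dotProduct {p : ℕ} (c : ℕ → ℝ) (f : Fin p → ℝ) :
    f ⬝ᵥ ((∑ k ∈ Icc 1 p, c k • Bblock k p p) *ᵥ f) =
      ∑ k ∈ Icc 1 p, c k * (f ⬝ᵥ (Bblock k p p *ᵥ f)) := by
  simp only [Matrix.sum_mulVec, dotProduct_sum, smul_mulVec, dotProduct_smul, smul_eq_mul]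

/-- A combination of nested centering blocks dominates each of its Abel summands when the tail
sums of its coefficients are nonnegative. -/
theorem le_dotProduct_sum_smul_Bblock {p : ℕ} {c G : ℕ → ℝ}
    (hc : ∀ k ∈ Icc 1 p, c k = G k - G (k - 1)) (hG : ∀ k < p, G k ≤ G p)
    (f : Fin p → ℝ) {k : ℕ} (hk : k ∈ Icc 1 p) :
    (G p - G (k - 1)) * (f ⬝ᵥ (Bblock k p p *ᵥ f) - f ⬝ᵥ (Bblock (k - 1) p p *ᵥ f)) ≤
      f ⬝ᵥ ((∑ k ∈ Icc 1 p, c k • Bblock k p p) *ᵥ f) := by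
  have key : ∀ k ∈ Icc 1 p, 0 ≤
      (G p - G (k - 1)) * (f ⬝ᵥ (Bblock k p p *ᵥ f) - f ⬝ᵥ (Bblock (k - 1) p p *ᵥ f)) := by
    intro k hk
    rw [Finset.mem_Icc] at hk
    have h1 := hG (k - 1) (by omega)
    have h2 := dotProduct_Bblock_mono (show k - 1 < p by omega) f
    rw [Nat.sub_add_cancel hk.1] at h2
    exact mul_nonneg (by linarith) (by linarith)
  rw [sum_smul_Bblock_mulVec_dotProduct, Finset.sum_congr rfl fun k hk => by rw [hc k hk],
    sum_Icc_sub_mul G (fun k => f ⬝ᵥ (Bblock k p p *ᵥ f)) (by simp [dotProduct_Bblock_mulVec]) p]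
  exact Finset.single_le_sum key hk

theorem sum_smul_Bblock_transpose {p : ℕ} (c : ℕ → ℝ) :
    (∑ k ∈ Icc 1 p, c k • Bblock k p p)ᵀ = ∑ k ∈ Icc 1 p, c k • Bblock k p p := by
  simp [Matrix.transpose_sum, Bblock_transpose]

theorem posSemidef_sum_smul_Bblock {p : ℕ} {c G : ℕ → ℝ}
    (hc : ∀ k ∈ Icc 1 p, c k = G k - G (k - 1)) (hG : ∀ k < p, G k ≤ G p) :
    (∑ k ∈ Icc 1 p, c k • Bblock k p p).PosSemidef := by
  refine PosSemidef.of_dotProduct_mulVec_nonneg ?_ fun f => ?_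
  · rw [IsHermitian, conjTranspose_eq_transpose_of_trivial, sum_smul_Bblock_transpose]
  · rw [star_trivial]
    rcases Nat.eq_zero_or_pos p with rfl | hp
    · simp
    · refine le_trans ?_ (le_dotProduct_sum_smul_Bblock hc hG f (Finset.mem_Icc.2 ⟨le_rfl, hp⟩))
      have h2 := dotProduct_Bblock_mono hp f
      have h1 := hG 0 hp
      simp only [Nat.sub_self]
      exact mul_nonneg (by linarith) (by rw [zero_add] at h2; linarith)

theorem sum_smul_Bblock_mulVec_one {p : ℕ} (c : ℕ → ℝ) :
    (∑ k ∈ Icc 1 p, c k • Bblock k p p) *ᵥ (1 : Fin p → ℝ) = 0 := by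
  rw [Matrix.sum_mulVec]
  refine Finset.sum_eq_zero fun k hk => ?_
  rw [smul_mulVec, Bblock_mulVec_one (Finset.mem_Icc.1 hk).2, smul_zero]

end

section

/-- `a` is the distribution of a dropout time on `{1, …, p}` that is not concentrated at `1`. -/
def IsDropoutDist (p : ℕ) (a : ℕ → ℝ) : Prop :=
  (∀ k ∈ Icc 1 p, 0 ≤ a k) ∧ ∑ k ∈ Icc 1 p, a k = 1 ∧ ∃ k ∈ Icc 2 p, 0 < a k

/-- `α_k` is the increment of this function at `k`. -/
def alphaCum (n : ℕ) (a : ℕ → ℝ) (k : ℕ) : ℝ :=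
  (((n : ℝ) + 1) * aInt a 1 k - aInt a 1 k ^ (n + 1)) / n

/-- `β_k` is the increment of this function at `k`. -/
def betaCum (n : ℕ) (a : ℕ → ℝ) (k : ℕ) : ℝ :=
  aInt a 1 k + (1 - aInt a 1 k) * aInt a 1 k ^ n

theorem aInt_one_eq (a : ℕ → ℝ) {k : ℕ} (hk : 1 ≤ k) : aInt a 1 k = aInt a 1 (k - 1) + a k := by
  obtain ⟨k, rfl⟩ := Nat.exists_eq_add_of_le' hk
  simp [aInt, Finset.sum_Icc_succ_top]

theorem aInt_add_aInt (a : ℕ → ℝ) {k p : ℕ} (hk : k ≤ p) :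
    aInt a 1 k + aInt a (k + 1) p = aInt a 1 p := by
  simp only [aInt]
  rw [← Finset.sum_union]
  · congr 1; ext i; simp; omega
  · rw [Finset.disjoint_left]; intro i; simp; omega

theorem alphaCoef_eq (n : ℕ) (a : ℕ → ℝ) {k : ℕ} (hk : 1 ≤ k) :
    alphaCoef n a k = alphaCum n a k - alphaCum n a (k - 1) := by
  simp only [alphaCoef, alphaCum, aInt_one_eq a hk]; ring

theorem alphaCum_le {n : ℕ} (hn : 1 ≤ n) {x : ℝ} (hx0 : 0 ≤ x) :
    (((n : ℝ) + 1) * x - x ^ (n + 1)) / n ≤ 1 - (1 - x) ^ 2 := by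
  have hn' : (0 : ℝ) < n := by exact_mod_cast hn
  have h := one_add_mul_le_pow (show (-2 : ℝ) ≤ x - 1 by linarith) n
  rw [add_sub_cancel] at h
  rw [div_le_iff₀ hn', pow_succ]
  nlinarith [mul_le_mul_of_nonneg_right h hx0]

theorem succ_mul_pow_le (m : ℕ) {x : ℝ} (hx0 : 0 ≤ x) (hx1 : x ≤ 1) :
    ((m : ℝ) + 1) * x ^ m ≤ 1 + m * x ^ (m + 1) := by
  induction m with
  | zero => simp
  | succ m ih =>
    have h1 := mul_le_mul_of_nonneg_right ih hx0
    have h2 : x ^ (m + 1) ≤ 1 := pow_le_one₀ hx0 hx1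
    have h3 := mul_nonneg (sub_nonneg.2 hx1) (sub_nonneg.2 h2)
    push_cast
    simp only [pow_succ] at *
    linarith

theorem betaCum_le {n : ℕ} (hn : 1 ≤ n) {x : ℝ} (hx0 : 0 ≤ x) (hx1 : x ≤ 1) :
    x + (1 - x) * x ^ n ≤ (((n : ℝ) + 1) * x - x ^ (n + 1)) / n := by
  obtain ⟨m, rfl⟩ := Nat.exists_eq_add_of_le' hn
  have h := mul_le_mul_of_nonneg_right (succ_mul_pow_le m hx0 hx1) hx0
  rw [le_div_iff₀ (by positivity)]
  push_cast
  simp only [pow_succ] at *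
  linarith

namespace IsDropoutDist

variable {p n : ℕ} {a : ℕ → ℝ}

theorem betaCoef_eq (h : IsDropoutDist p a) (n : ℕ) {k : ℕ} (hk : k ∈ Icc 1 p) :
    betaCoef p n a k = betaCum n a k - betaCum n a (k - 1) := by
  rw [Finset.mem_Icc] at hk
  have h1 := aInt_add_aInt a hk.2
  have h2 := aInt_add_aInt a (show k - 1 ≤ p by omega)
  rw [Nat.sub_add_cancel hk.1] at h2
  have h3 : aInt a 1 p = 1 := h.2.1
  have h4 : a k = aInt a 1 k - aInt a 1 (k - 1) := by rw [aInt_one_eq a hk.1]; ring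
  simp only [betaCoef, betaCum]
  rw [show aInt a (k + 1) p = 1 - aInt a 1 k by linarith,
    show aInt a k p = 1 - aInt a 1 (k - 1) by linarith, h4]
  ring

theorem aInt_nonneg (h : IsDropoutDist p a) {k : ℕ} (hk : k ≤ p) : 0 ≤ aInt a 1 k :=
  Finset.sum_nonneg fun i hi => h.1 i (Finset.Icc_subset_Icc_right hk hi)

theorem aInt_le_one (h : IsDropoutDist p a) {k : ℕ} (hk : k ≤ p) : aInt a 1 k ≤ 1 := by
  rw [← h.2.1]
  exact Finset.sum_le_sum_of_subset_of_nonneg (Finset.Icc_subset_Icc_right hk)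
    fun i hi _ => h.1 i hi

theorem aInt_lt_one (h : IsDropoutDist p a) {k m : ℕ} (hk : k < m) (hm : m ∈ Icc 1 p)
    (ham : 0 < a m) : aInt a 1 k < 1 := by
  rw [← h.2.1]
  rw [Finset.mem_Icc] at hm
  refine Finset.sum_lt_sum_of_subset (i := m) (Finset.Icc_subset_Icc_right (by omega))
    (Finset.mem_Icc.2 hm) (by simp; omega) ham fun i hi _ => h.1 i hi

theorem alphaCum_top (h : IsDropoutDist p a) (hn : 1 ≤ n) : alphaCum n a p = 1 := by
  have h3 : aInt a 1 p = 1 := h.2.1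
  have hn' : (n : ℝ) ≠ 0 := by exact_mod_cast (by omega : n ≠ 0)
  simp [alphaCum, h3, hn']

theorem betaCum_top (h : IsDropoutDist p a) : betaCum n a p = 1 := by
  have h3 : aInt a 1 p = 1 := h.2.1
  simp [betaCum, h3]

theorem alphaCum_le_top (h : IsDropoutDist p a) (hn : 1 ≤ n) {k : ℕ} (hk : k < p) :
    alphaCum n a k ≤ alphaCum n a p := by
  rw [h.alphaCum_top hn]
  have := alphaCum_le hn (h.aInt_nonneg hk.le)
  unfold alphaCum
  nlinarith [sq_nonneg (1 - aInt a 1 k)]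

theorem posSemidef_Amat (h : IsDropoutDist p a) (hn : 1 ≤ n) : (Amat p n a).PosSemidef :=
  posSemidef_sum_smul_Bblock (fun _ hk => alphaCoef_eq n a (Finset.mem_Icc.1 hk).1)
    fun _ hk => h.alphaCum_le_top hn hk

theorem posSemidef_Bmat_sub_Amat (h : IsDropoutDist p a) (hn : 1 ≤ n) :
    (Bmat p n a - Amat p n a).PosSemidef := by
  have : Bmat p n a - Amat p n a =
      ∑ k ∈ Icc 1 p, (betaCoef p n a k - alphaCoef n a k) • Bblock k p p := by
    simp only [Bmat, Amat, sub_smul, Finset.sum_sub_distrib]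
  rw [this]
  refine posSemidef_sum_smul_Bblock (G := fun k => betaCum n a k - alphaCum n a k)
    (fun k hk => ?_) fun k hk => ?_
  · rw [alphaCoef_eq n a (Finset.mem_Icc.1 hk).1, h.betaCoef_eq n hk]; ring
  · rw [h.alphaCum_top hn, h.betaCum_top]
    have := betaCum_le hn (h.aInt_nonneg hk.le) (h.aInt_le_one hk.le)
    simp only [alphaCum, betaCum]
    linarith

/-- The form of `A` controls the contrast between the first two periods. -/
theorem exists_mul_sq_le (h : IsDropoutDist p a) (hn : 1 ≤ n) (hp : 2 ≤ p) :
    ∃ c : ℝ, 0 < c ∧ ∀ f : Fin p → ℝ,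
      c * (f ⟨0, by omega⟩ - f ⟨1, hp⟩) ^ 2 ≤ f ⬝ᵥ (Amat p n a *ᵥ f) := by
  obtain ⟨m, hm, ham⟩ := h.2.2
  rw [Finset.mem_Icc] at hm
  have hx := h.aInt_lt_one (k := 1) (by omega) (Finset.mem_Icc.2 ⟨by omega, hm.2⟩) ham
  have h1 := alphaCum_le hn (h.aInt_nonneg (show 1 ≤ p by omega))
  have h2 : 0 < (1 - aInt a 1 1) ^ 2 := pow_pos (sub_pos.2 hx) 2
  refine ⟨(1 - alphaCum n a 1) / 2, by unfold alphaCum; linarith, fun f => ?_⟩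
  have h3 := le_dotProduct_sum_smul_Bblock (c := alphaCoef n a) (G := alphaCum n a)
    (fun k hk => alphaCoef_eq n a (Finset.mem_Icc.1 hk).1)
    (fun _ hk => h.alphaCum_le_top hn hk) f (Finset.mem_Icc.2 ⟨one_le_two, hp⟩)
  refine le_trans (le_of_eq ?_) h3
  rw [h.alphaCum_top hn]
  simp only [dotProduct_Bblock_mulVec, show 2 - 1 = 1 from rfl,
    sum_ite_lt_succ _ hp, show 2 = 1 + 1 from rfl,
    show (∀ g : Fin p → ℝ, (∑ j : Fin p, if (j : ℕ) < 1 then g j else 0) = g ⟨0, by omega⟩) from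
      fun g => (sum_ite_lt_succ g (show 0 < p by omega)).trans (by simp)]
  push_cast
  ring

theorem exists_last (h : IsDropoutDist p a) : ∃ m ∈ Icc 2 p, 0 < a m ∧
    ∀ k ∈ Icc 1 p, m < k → a k = 0 ∧ aInt a 1 k = 1 ∧ aInt a 1 (k - 1) = 1 := by
  classical
  obtain ⟨m, hm, hmax⟩ := ((Icc 2 p).filter (0 < a ·)).exists_max_image id (by
    obtain ⟨k, hk, hak⟩ := h.2.2
    exact ⟨k, by simp_all⟩)
  rw [Finset.mem_filter] at hm
  have h0 : ∀ k ∈ Icc 1 p, m < k → a k = 0 := by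
    intro k hk hmk
    rw [Finset.mem_Icc] at hk
    by_contra hne
    have := hmax k (by
      simp only [Finset.mem_filter, Finset.mem_Icc]
      have := Finset.mem_Icc.1 hm.1
      exact ⟨by omega, lt_of_le_of_ne (h.1 k (Finset.mem_Icc.2 hk)) (Ne.symm hne)⟩)
    simp at this; omega
  have h1 : ∀ k, m ≤ k → k ≤ p → aInt a 1 k = 1 := by
    intro k hmk hkp
    have := aInt_add_aInt a hkp
    have h3 : aInt a 1 p = 1 := h.2.1
    have h4 : aInt a (k + 1) p = 0 := Finset.sum_eq_zero fun i hi => by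
      rw [Finset.mem_Icc] at hi
      exact h0 i (Finset.mem_Icc.2 ⟨by omega, hi.2⟩) (by omega)
    linarith
  refine ⟨m, hm.1, hm.2, fun k hk hmk => ?_⟩
  have := Finset.mem_Icc.1 hk
  exact ⟨h0 k hk hmk, h1 k hmk.le this.2, h1 (k - 1) (by omega) (by omega)⟩

/-- The last row of the support of `A` acts as a nonzero multiple of the contrast with the mean of
all periods up to it, and neither `A` nor `B` sees later periods. -/
theorem exists_last_row (h : IsDropoutDist p a) (hn : 1 ≤ n) :
    ∃ (m : Fin p) (c : ℝ), 1 ≤ (m : ℕ) ∧ 0 < c ∧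
      (∀ f : Fin p → ℝ, (Amat p n a *ᵥ f) m =
        c * (f m - (∑ j : Fin p, if (j : ℕ) < m + 1 then f j else 0) / ((m : ℕ) + 1 : ℕ))) ∧
      ∀ f g : Fin p → ℝ, (∀ j ≤ m, f j = g j) →
        Amat p n a *ᵥ f = Amat p n a *ᵥ g ∧ Bmat p n a *ᵥ f = Bmat p n a *ᵥ g := by
  obtain ⟨m, hm, ham, hlast⟩ := h.exists_last
  rw [Finset.mem_Icc] at hm
  have hx := h.aInt_lt_one (k := m - 1) (by omega) (Finset.mem_Icc.2 ⟨by omega, hm.2⟩) ham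
  have h1 := alphaCum_le hn (h.aInt_nonneg (show m - 1 ≤ p by omega))
  have h2 : 0 < (1 - aInt a 1 (m - 1)) ^ 2 := pow_pos (sub_pos.2 hx) 2
  have hn' : (n : ℝ) ≠ 0 := by exact_mod_cast (by omega : n ≠ 0)
  have hα0 : ∀ k ∈ Icc 1 p, m < k → alphaCoef n a k = 0 := by
    intro k hk hmk
    obtain ⟨e1, e2, e3⟩ := hlast k hk hmk
    simp [alphaCoef, e1, e2, e3]
  have hβ0 : ∀ k ∈ Icc 1 p, m < k → betaCoef p n a k = 0 := by
    intro k hk hmk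
    obtain ⟨e1, e2, e3⟩ := hlast k hk hmk
    rw [h.betaCoef_eq n hk]
    simp [betaCum, e2, e3]
  have htop : alphaCum n a m = 1 := by
    rcases eq_or_lt_of_le hm.2 with e | e
    · rw [e, h.alphaCum_top hn]
    · obtain ⟨-, -, e3⟩ := hlast (m + 1) (Finset.mem_Icc.2 ⟨by omega, e⟩) (by omega)
      rw [Nat.add_sub_cancel] at e3
      simp [alphaCum, e3, hn']
  refine ⟨⟨m - 1, by omega⟩, alphaCoef n a m, by simp; omega, ?_, fun f => ?_, fun f g hfg => ?_⟩
  · rw [alphaCoef_eq n a (by omega), htop]; unfold alphaCum; linarith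
  · simp only [Amat, Matrix.sum_mulVec, smul_mulVec, Finset.sum_apply, Pi.smul_apply,
      smul_eq_mul, Bblock_mulVec]
    rw [Finset.sum_eq_single_of_mem m (Finset.mem_Icc.2 ⟨by omega, hm.2⟩)]
    · simp [show m - 1 < m by omega, Nat.sub_add_cancel (show 1 ≤ m by omega)]
    · intro k hk hne
      rcases lt_or_gt_of_ne hne with h' | h'
      · rw [if_neg (by omega), mul_zero]
      · rw [hα0 k hk h', zero_mul]
  · have key : ∀ k ≤ m, Bblock k p p *ᵥ f = Bblock k p p *ᵥ g := by
      intro k hk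
      have hfg' : ∀ j : Fin p, (j : ℕ) < k → f j = g j := fun j hj =>
        hfg j (Fin.le_def.2 (by simp; omega))
      ext i
      rw [Bblock_mulVec, Bblock_mulVec]
      have : (∑ j : Fin p, if (j : ℕ) < k then f j else 0) =
          ∑ j : Fin p, if (j : ℕ) < k then g j else 0 :=
        Finset.sum_congr rfl fun j _ => by
          split_ifs with hj
          · exact hfg' j hj
          · rfl
      rw [this]
      split_ifs with hi
      · rw [hfg' i hi]
      · rfl
    simp only [Amat, Bmat, Matrix.sum_mulVec, smul_mulVec]
    constructor <;> refine Finset.sum_congr rfl fun k hk => ?_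
    · rcases le_or_gt k m with h' | h'
      · rw [key k h']
      · rw [hα0 k hk h', zero_smul, zero_smul]
    · rcases le_or_gt k m with h' | h'
      · rw [key k h']
      · rw [hβ0 k hk h', zero_smul, zero_smul]

end IsDropoutDist

theorem Amat_transpose (p n : ℕ) (a : ℕ → ℝ) : (Amat p n a)ᵀ = Amat p n a :=
  sum_smul_Bblock_transpose _

theorem Bmat_transpose (p n : ℕ) (a : ℕ → ℝ) : (Bmat p n a)ᵀ = Bmat p n a :=
  sum_smul_Bblock_transpose _

theorem Amat_mulVec_one (p n : ℕ) (a : ℕ → ℝ) : Amat p n a *ᵥ 1 = 0 :=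
  sum_smul_Bblock_mulVec_one _

theorem Bmat_mulVec_one (p n : ℕ) (a : ℕ → ℝ) : Bmat p n a *ᵥ 1 = 0 :=
  sum_smul_Bblock_mulVec_one _

end

section

theorem Bsq_eq (t : ℕ) : Bsq t = 1 - (t : ℝ)⁻¹ • vecMulVec (1 : Fin t → ℝ) 1 := by
  ext i j
  simp [Bsq, Bblock, Matrix.one_apply, Fin.ext_iff]

theorem Bsq_transpose (t : ℕ) : (Bsq t)ᵀ = Bsq t := Bblock_transpose t t

theorem Bsq_mulVec_one (t : ℕ) : Bsq t *ᵥ 1 = 0 := Bblock_mulVec_one le_rfl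

theorem Bsq_mul_Bsq (t : ℕ) : Bsq t * Bsq t = Bsq t := by
  conv_lhs => enter [1]; rw [Bsq_eq t]
  rw [Matrix.sub_mul, Matrix.one_mul, Matrix.smul_mul, vecMulVec_mul,
    ← mulVec_transpose, Bsq_transpose, Bsq_mulVec_one]
  simp [vecMulVec_zero]

variable {p t : ℕ}

theorem Tmat_mulVec (s : Fin p → Fin t) (u : Fin t → ℝ) (k : Fin p) :
    (Tmat s *ᵥ u) k = u (s k) := by
  simp [Tmat, mulVec, dotProduct]

theorem Tmat_mulVec_one (s : Fin p → Fin t) : Tmat s *ᵥ 1 = 1 := by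
  ext k; simp [Tmat_mulVec]

theorem Fmat_mulVec (s : Fin p → Fin t) (u : Fin t → ℝ) (k : Fin p) :
    (Fmat s *ᵥ u) k = if (k : ℕ) = 0 then 0 else
      u (s ⟨(k : ℕ) - 1, lt_of_le_of_lt (Nat.sub_le _ _) k.isLt⟩) := by
  by_cases hk : (k : ℕ) = 0 <;> simp [Fmat, mulVec, dotProduct, hk]

/-- The indicator of the first period. -/
def firstPeriod (p : ℕ) : Fin p → ℝ := fun k => if (k : ℕ) = 0 then 1 else 0

theorem Fmat_mulVec_one (s : Fin p → Fin t) : Fmat s *ᵥ 1 = 1 - firstPeriod p := by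
  ext k
  rw [Fmat_mulVec]
  by_cases hk : (k : ℕ) = 0 <;> simp [hk, firstPeriod]

theorem Tmat_eq (s : Fin p → Fin t) :
    Tmat s = Tmat s * Bsq t + (t : ℝ)⁻¹ • vecMulVec 1 1 := by
  rw [Bsq_eq, Matrix.mul_sub, Matrix.mul_one, Matrix.mul_smul, mul_vecMulVec, Tmat_mulVec_one]
  abel

section Forms

variable {σ m k : Type*} [Fintype σ] [Fintype m] [Fintype k]

theorem sum_trace_sub_le {A B : Matrix m m ℝ} (hA : A.PosSemidef) (hD : (B - A).PosSemidef)
    {w : σ → ℝ} (hw : ∑ s, w s = 1) (H : σ → Matrix m k ℝ) (E : Matrix m k ℝ) :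
    ∑ s, w s * ((H s - E)ᵀ * A * (H s - E)).trace -
        ((∑ s, w s • (H s - E))ᵀ * B * ∑ s, w s • (H s - E)).trace ≤
      ∑ s, w s * ((H s)ᵀ * A * H s).trace := by
  set M := ∑ s, w s • H s with hM
  have e1 : ∑ s, w s • (H s - E) = M - E := by
    simp only [smul_sub, Finset.sum_sub_distrib, ← Finset.sum_smul, hw, one_smul, hM]
  have e2 : ∑ s, w s * ((H s)ᵀ * A * E).trace = (Mᵀ * A * E).trace := by
    simp [hM, Matrix.transpose_sum, Matrix.sum_mul, Matrix.trace_sum]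
  have e3 : ∑ s, w s * (Eᵀ * A * H s).trace = (Eᵀ * A * M).trace := by
    simp [hM, Matrix.mul_sum, Matrix.trace_sum]
  have e4 : ∑ s, w s * (Eᵀ * A * E).trace = (Eᵀ * A * E).trace := by
    rw [← Finset.sum_mul, hw, one_mul]
  have h1 := (hA.conjTranspose_mul_mul_same M).trace_nonneg
  have h2 := (hD.conjTranspose_mul_mul_same (M - E)).trace_nonneg
  rw [conjTranspose_eq_transpose_of_trivial] at h1 h2
  have e5 : ∑ s, w s * ((H s - E)ᵀ * A * (H s - E)).trace =
      ∑ s, w s * ((H s)ᵀ * A * H s).trace - (Mᵀ * A * E).trace - (Eᵀ * A * M).trace +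
        (Eᵀ * A * E).trace := by
    rw [← e2, ← e3]
    conv_rhs => rw [← e4]
    rw [← Finset.sum_sub_distrib, ← Finset.sum_sub_distrib, ← Finset.sum_add_distrib]
    refine Finset.sum_congr rfl fun s _ => ?_
    simp only [transpose_sub, Matrix.sub_mul, Matrix.mul_sub, trace_sub]
    ring
  rw [e1, e5]
  simp only [transpose_sub, Matrix.sub_mul, Matrix.mul_sub, trace_sub] at h2 ⊢
  linarith

theorem sum_add_mul_form {A B : Matrix m m ℝ} (hA : Aᵀ = A) (hB : Bᵀ = B)
    (w : σ → ℝ) (T F : σ → Matrix m k ℝ) (X : Matrix k k ℝ) :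
    (∑ s, w s • ((T s)ᵀ * A * T s) - (∑ s, w s • T s)ᵀ * B * ∑ s, w s • T s) +
      (∑ s, w s • ((T s)ᵀ * A * F s) - (∑ s, w s • T s)ᵀ * B * ∑ s, w s • F s) * X +
      Xᵀ * (∑ s, w s • ((T s)ᵀ * A * F s) - (∑ s, w s • T s)ᵀ * B * ∑ s, w s • F s)ᵀ +
      Xᵀ * (∑ s, w s • ((F s)ᵀ * A * F s) - (∑ s, w s • F s)ᵀ * B * ∑ s, w s • F s) * X =
    ∑ s, w s • ((T s + F s * X)ᵀ * A * (T s + F s * X)) -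
      (∑ s, w s • (T s + F s * X))ᵀ * B * ∑ s, w s • (T s + F s * X) := by
  have e : ∑ s, w s • (T s + F s * X) = ∑ s, w s • T s + (∑ s, w s • F s) * X := by
    simp only [smul_add, Finset.sum_add_distrib, Matrix.sum_mul, Matrix.smul_mul]
  rw [e]
  generalize (∑ s, w s • T s) = U
  generalize (∑ s, w s • F s) = V
  simp only [transpose_add, transpose_sub, transpose_mul, transpose_transpose, transpose_smul,
    Matrix.transpose_sum, hA, hB, Matrix.add_mul, Matrix.mul_add, Matrix.sub_mul, Matrix.mul_sub,
    smul_add, Finset.sum_add_distrib, Matrix.sum_mul, Matrix.mul_sum, Matrix.smul_mul,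
    Matrix.mul_smul, Matrix.mul_assoc]
  abel

end Forms

theorem qfun_eq_trace (n : ℕ) (a : ℕ → ℝ) (s : Fin p → Fin t) (x : ℝ) :
    qfun p t n a s x = ((Tmat s * Bsq t + x • (Fmat s * Bsq t))ᵀ * Amat p n a *
      (Tmat s * Bsq t + x • (Fmat s * Bsq t))).trace := by
  have h : (Bsq t * (Fmat s)ᵀ * Amat p n a * Tmat s * Bsq t).trace = q12 p t n a s := by
    rw [q12, ← trace_transpose]
    simp only [transpose_mul, transpose_transpose, Bsq_transpose, Amat_transpose,
      Matrix.mul_assoc]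
  simp only [transpose_add, transpose_smul, transpose_mul, Bsq_transpose, Matrix.add_mul,
    Matrix.mul_add, Matrix.smul_mul, Matrix.mul_smul, trace_add, trace_smul, smul_eq_mul]
  simp only [← Matrix.mul_assoc, h]
  simp only [qfun, q11, q22]
  rw [show (Bsq t * (Tmat s)ᵀ * Amat p n a * Fmat s * Bsq t).trace = q12 p t n a s from rfl]
  ring

theorem info_eq_form (n : ℕ) (a : ℕ → ℝ) (P : (Fin p → Fin t) → ℝ)
    (X : Matrix (Fin t) (Fin t) ℝ) :
    C11 p t n a P + C12 p t n a P * X + Xᵀ * (C12 p t n a P)ᵀ + Xᵀ * C22 p t n a P * X =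
      (n : ℝ) • (∑ s, P s • ((Tmat s + Fmat s * X)ᵀ * Amat p n a * (Tmat s + Fmat s * X)) -
        (∑ s, P s • (Tmat s + Fmat s * X))ᵀ * Bmat p n a *
          ∑ s, P s • (Tmat s + Fmat s * X)) := by
  rw [← sum_add_mul_form (Amat_transpose p n a) (Bmat_transpose p n a)]
  simp only [C11, C12, C22, Tbar, Fbar, smul_add, Matrix.smul_mul, Matrix.mul_smul,
    transpose_smul]

theorem trace_info_le {n : ℕ} {a : ℕ → ℝ} (h : IsDropoutDist p a) (hn : 1 ≤ n)
    {P : (Fin p → Fin t) → ℝ} (hP : IsDesign P) (x : ℝ) (w : Fin t → ℝ)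
    {X : Matrix (Fin t) (Fin t) ℝ} (hX : X = x • Bsq t + vecMulVec 1 w) :
    (C11 p t n a P + C12 p t n a P * X + Xᵀ * (C12 p t n a P)ᵀ + Xᵀ * C22 p t n a P * X).trace ≤
      n * ∑ s, P s * qfun p t n a s x := by
  set E : Matrix (Fin p) (Fin t) ℝ :=
    -((t : ℝ)⁻¹ • vecMulVec 1 1 + vecMulVec (1 - firstPeriod p) w) with hE
  have e : ∀ s : Fin p → Fin t, Tmat s + Fmat s * X =
      (Tmat s * Bsq t + x • (Fmat s * Bsq t)) - E := by
    intro s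
    rw [hX, Matrix.mul_add, Matrix.mul_smul, mul_vecMulVec, Fmat_mulVec_one, hE]
    conv_lhs => rw [Tmat_eq s]
    abel
  rw [info_eq_form]
  simp only [e, qfun_eq_trace, trace_smul, trace_sub, trace_sum, smul_eq_mul]
  exact mul_le_mul_of_nonneg_left (sum_trace_sub_le (h.posSemidef_Amat hn)
    (h.posSemidef_Bmat_sub_Amat hn) hP.2 _ _) (Nat.cast_nonneg n)

end

section

section ElimOnes

variable {ι : Type*} [Fintype ι]

/-- The Schur-type reduction of a quadratic form `C` that eliminates the constant vector. -/
def elimOnes (C : Matrix ι ι ℝ) : Matrix ι ι ℝ :=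
  C - ((1 : ι → ℝ) ⬝ᵥ (C *ᵥ 1))⁻¹ • vecMulVec (C *ᵥ 1) (C *ᵥ 1)

theorem elimOnes_mulVec (C : Matrix ι ι ℝ) (u : ι → ℝ) :
    elimOnes C *ᵥ u = C *ᵥ u - (((1 : ι → ℝ) ⬝ᵥ (C *ᵥ 1))⁻¹ * ((C *ᵥ 1) ⬝ᵥ u)) • (C *ᵥ 1) := by
  rw [elimOnes, sub_mulVec, smul_mulVec, vecMulVec_mulVec, mul_smul]
  ext i
  simp

theorem elimOnes_transpose {C : Matrix ι ι ℝ} (hC : Cᵀ = C) : (elimOnes C)ᵀ = elimOnes C := by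
  simp [elimOnes, hC, transpose_vecMulVec]

theorem elimOnes_mulVec_one {C : Matrix ι ι ℝ}
    (h0 : (1 : ι → ℝ) ⬝ᵥ (C *ᵥ 1) = 0 → C *ᵥ (1 : ι → ℝ) = 0) : elimOnes C *ᵥ 1 = 0 := by
  rw [elimOnes_mulVec, dotProduct_comm _ (1 : ι → ℝ)]
  by_cases h : (1 : ι → ℝ) ⬝ᵥ (C *ᵥ 1) = 0
  · simp [h0 h]
  · rw [inv_mul_cancel₀ h, one_smul, sub_self]

theorem exists_mulVec_add_eq_zero {C : Matrix ι ι ℝ} {u : ι → ℝ} (hu : elimOnes C *ᵥ u = 0) :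
    ∃ c : ℝ, C *ᵥ (u + c • 1) = 0 := by
  refine ⟨-(((1 : ι → ℝ) ⬝ᵥ (C *ᵥ 1))⁻¹ * ((C *ᵥ 1) ⬝ᵥ u)), ?_⟩
  rw [elimOnes_mulVec] at hu
  rw [mulVec_add, mulVec_smul, neg_smul, ← sub_eq_add_neg, hu]

end ElimOnes

variable {p t n : ℕ} {a : ℕ → ℝ} {P : (Fin p → Fin t) → ℝ}

theorem C22_transpose (p t n : ℕ) (a : ℕ → ℝ) (P : (Fin p → Fin t) → ℝ) :
    (C22 p t n a P)ᵀ = C22 p t n a P := by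
  simp [C22, Matrix.transpose_sum, transpose_mul, Amat_transpose, Bmat_transpose,
    Matrix.mul_assoc]

theorem Fbar_mulVec_one (hP : IsDesign P) : Fbar P *ᵥ 1 = 1 - firstPeriod p := by
  rw [Fbar, Matrix.sum_mulVec]
  simp only [smul_mulVec, Fmat_mulVec_one, ← Finset.sum_smul, hP.2, one_smul]

theorem Tbar_mulVec_one (hP : IsDesign P) : Tbar P *ᵥ 1 = 1 := by
  rw [Tbar, Matrix.sum_mulVec]
  simp only [smul_mulVec, Tmat_mulVec_one, ← Finset.sum_smul, hP.2, one_smul]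

theorem C22_mulVec_one (hP : IsDesign P) : C22 p t n a P *ᵥ 1 =
    (n : ℝ) • ((Fbar P)ᵀ *ᵥ ((Bmat p n a - Amat p n a) *ᵥ firstPeriod p)) := by
  have h : (∑ s, P s • ((Fmat s)ᵀ * Amat p n a * Fmat s)) *ᵥ 1 =
      -((Fbar P)ᵀ *ᵥ (Amat p n a *ᵥ firstPeriod p)) := by
    rw [Matrix.sum_mulVec, Fbar, Matrix.transpose_sum, Matrix.sum_mulVec, ← Finset.sum_neg_distrib]
    refine Finset.sum_congr rfl fun s _ => ?_
    rw [smul_mulVec, transpose_smul, smul_mulVec, ← mulVec_mulVec, Fmat_mulVec_one,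
      ← mulVec_mulVec, mulVec_sub (Amat p n a), Amat_mulVec_one, zero_sub, mulVec_neg, smul_neg]
  rw [C22, smul_mulVec, sub_mulVec, h, ← mulVec_mulVec, Fbar_mulVec_one hP, ← mulVec_mulVec,
    mulVec_sub (Bmat p n a), Bmat_mulVec_one, zero_sub, mulVec_neg, sub_mulVec, mulVec_sub]
  congr 1
  abel

theorem one_dotProduct_C22_mulVec_one (hP : IsDesign P) :
    (1 : Fin t → ℝ) ⬝ᵥ (C22 p t n a P *ᵥ 1) =
      -(n * (firstPeriod p ⬝ᵥ ((Bmat p n a - Amat p n a) *ᵥ firstPeriod p))) := by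
  have h1 : (1 : Fin p → ℝ) ⬝ᵥ ((Bmat p n a - Amat p n a) *ᵥ firstPeriod p) = 0 := by
    rw [dotProduct_mulVec, ← mulVec_transpose, transpose_sub, Amat_transpose, Bmat_transpose,
      sub_mulVec, Amat_mulVec_one, Bmat_mulVec_one]
    simp
  rw [C22_mulVec_one hP, dotProduct_smul, dotProduct_mulVec, vecMul_transpose,
    Fbar_mulVec_one hP, sub_dotProduct, h1, smul_eq_mul]
  ring

theorem C22_mulVec_one_eq_zero (h : IsDropoutDist p a) (hn : 1 ≤ n) (hP : IsDesign P)
    (h0 : (1 : Fin t → ℝ) ⬝ᵥ (C22 p t n a P *ᵥ 1) = 0) : C22 p t n a P *ᵥ 1 = 0 := by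
  have hn' : (n : ℝ) ≠ 0 := by exact_mod_cast (by omega : n ≠ 0)
  rw [one_dotProduct_C22_mulVec_one hP, neg_eq_zero, mul_eq_zero, or_iff_right hn'] at h0
  have := ((h.posSemidef_Bmat_sub_Amat hn).dotProduct_mulVec_zero_iff (firstPeriod p)).1
    (by rwa [star_trivial])
  rw [C22_mulVec_one hP, this]
  simp

theorem transpose_mul_mul_congr {k m : Type*} [Fintype m] {A : Matrix m m ℝ} (hA : Aᵀ = A)
    {F G : Matrix m k ℝ} (h : A * F = A * G) : Fᵀ * A * F = Gᵀ * A * G := by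
  have hT := congrArg transpose h
  rw [transpose_mul, transpose_mul, hA] at hT
  rw [Matrix.mul_assoc, h, ← Matrix.mul_assoc, hT]

/-- Moving the whole weight of the sequence `s₀` to `s₁`. -/
def moveWeight {σ : Type*} [DecidableEq σ] (Q : σ → ℝ) (s₀ s₁ : σ) : σ → ℝ :=
  Q + Q s₀ • (Pi.single s₁ 1 - Pi.single s₀ 1)

theorem sum_moveWeight_smul {σ M : Type*} [DecidableEq σ] [Fintype σ] [AddCommGroup M] [Module ℝ M]
    (Q : σ → ℝ) (s₀ s₁ : σ) (G : σ → M) :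
    ∑ s, moveWeight Q s₀ s₁ s • G s = ∑ s, Q s • G s + Q s₀ • (G s₁ - G s₀) := by
  have : ∀ s, moveWeight Q s₀ s₁ s • G s = Q s • G s +
      ((if s = s₁ then Q s₀ • G s else 0) - if s = s₀ then Q s₀ • G s else 0) := by
    intro s
    simp only [moveWeight, Pi.add_apply, Pi.smul_apply, Pi.sub_apply, Pi.single_apply, smul_eq_mul]
    split_ifs <;> module
  rw [Finset.sum_congr rfl fun s _ => this s, Finset.sum_add_distrib, Finset.sum_sub_distrib]
  simp [smul_sub]

theorem IsDesign.moveWeight (hP : IsDesign P) (s₀ s₁ : Fin p → Fin t) :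
    IsDesign (moveWeight P s₀ s₁) := by
  refine ⟨fun s => ?_, ?_⟩
  · have h0 := hP.1 s₀
    have h1 := hP.1 s
    simp only [_root_.moveWeight, Pi.add_apply, Pi.smul_apply, Pi.sub_apply, Pi.single_apply,
      smul_eq_mul]
    by_cases e : s = s₀
    · subst e; split_ifs <;> simp [h0]
    · simp only [e, if_false]; split_ifs <;> simp <;> linarith
  · have := sum_moveWeight_smul P s₀ s₁ (fun _ => (1 : ℝ))
    simpa [hP.2] using this

/-- If the null vectors of `C₂₂(Q)` are null vectors of `C₁₂(Q)` for every design `Q`, then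
`C₂₂` has only constant null vectors at designs with full support. -/
theorem eq_const_of_C22_mulVec_eq_zero (h : IsDropoutDist p a) (hn : 1 ≤ n) (ht : 2 ≤ t)
    (h12 : ∀ Q : (Fin p → Fin t) → ℝ, IsDesign Q → ∀ u : Fin t → ℝ,
      C22 p t n a Q *ᵥ u = 0 → C12 p t n a Q *ᵥ u = 0)
    (hP : IsDesign P) (hpos : ∀ s, 0 < P s) {u : Fin t → ℝ} (hu : C22 p t n a P *ᵥ u = 0) :
    ∃ c : ℝ, u = c • 1 := by
  classical
  obtain ⟨m, c, hm, hc, hrow, hcongr⟩ := h.exists_last_row hn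
  have hn' : (n : ℝ) ≠ 0 := by exact_mod_cast (by omega : n ≠ 0)
  have key : ∀ s₀ : Fin p → Fin t, (Amat p n a *ᵥ (Fmat s₀ *ᵥ u)) m =
      (Bmat p n a *ᵥ (Fbar P *ᵥ u)) m := by
    intro s₀
    have : Nontrivial (Fin t) := Fin.nontrivial_iff_two_le.2 ht
    obtain ⟨i, hi⟩ := exists_ne (s₀ m)
    set s₁ := Function.update s₀ m i with hs₁
    have hF : ∀ v, ∀ j ≤ m, (Fmat s₁ *ᵥ v) j = (Fmat s₀ *ᵥ v) j := by
      intro v j hj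
      rw [Fmat_mulVec, Fmat_mulVec]
      split_ifs with h0
      · rfl
      · rw [hs₁, Function.update_of_ne]
        intro e
        have e' := congrArg Fin.val e
        have := Fin.le_def.1 hj
        simp at e'
        omega
    have hAF : Amat p n a * Fmat s₁ = Amat p n a * Fmat s₀ := by
      refine Matrix.ext_of_mulVec_single fun j => ?_
      rw [← mulVec_mulVec, ← mulVec_mulVec]
      exact (hcongr _ _ (hF _)).1
    have hBF : Bmat p n a * Fmat s₁ = Bmat p n a * Fmat s₀ := by
      refine Matrix.ext_of_mulVec_single fun j => ?_
      rw [← mulVec_mulVec, ← mulVec_mulVec]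
      exact (hcongr _ _ (hF _)).2
    set Q := moveWeight P s₀ s₁ with hQ
    have hBbar : Bmat p n a * Fbar Q = Bmat p n a * Fbar P := by
      rw [Fbar, hQ, sum_moveWeight_smul, Matrix.mul_add, Matrix.mul_smul, Matrix.mul_sub, hBF]
      simp [Fbar]
    have h22 : C22 p t n a Q = C22 p t n a P := by
      rw [C22, C22, transpose_mul_mul_congr (Bmat_transpose p n a) hBbar, hQ, sum_moveWeight_smul,
        transpose_mul_mul_congr (Amat_transpose p n a) hAF]
      simp
    have e1 := h12 Q (hP.moveWeight s₀ s₁) u (by rw [h22, hu])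
    have e0 := h12 P hP u hu
    have e2 : C12 p t n a Q = C12 p t n a P + (n : ℝ) • P s₀ •
        ((Tmat s₁ - Tmat s₀)ᵀ * (Amat p n a * Fmat s₀ - Bmat p n a * Fbar P)) := by
      rw [C12, C12, Matrix.mul_assoc _ _ (Fbar Q), hBbar, hQ, sum_moveWeight_smul, Tbar,
        sum_moveWeight_smul, Matrix.mul_assoc _ _ (Fmat s₁), hAF, ← Tbar]
      simp only [transpose_add, transpose_sub, transpose_smul, Matrix.add_mul, Matrix.sub_mul,
        Matrix.mul_sub, Matrix.smul_mul, Matrix.mul_assoc]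
      module
    rw [e2, add_mulVec, e0, zero_add, smul_mulVec, smul_mulVec, smul_eq_zero_iff_right hn',
      smul_eq_zero_iff_right (hpos s₀).ne', ← mulVec_mulVec, sub_mulVec, ← mulVec_mulVec,
      ← mulVec_mulVec] at e1
    have e3 := congrFun e1 i
    simp only [mulVec, dotProduct, transpose_apply, Matrix.sub_apply, Pi.zero_apply] at e3
    rw [Finset.sum_eq_single m] at e3
    · simp only [Tmat, of_apply, hs₁, Function.update_self, if_true, if_neg hi.symm, sub_zero,
        one_mul, Pi.sub_apply] at e3
      exact sub_eq_zero.1 e3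
    · intro j _ hj
      simp [Tmat, hs₁, Function.update_of_ne hj]
    · simp
  set β := (Bmat p n a *ᵥ (Fbar P *ᵥ u)) m
  refine ⟨β * ((m : ℕ) + 1 : ℕ) / c, funext fun i => ?_⟩
  have hFc : Fmat (fun _ : Fin p => i) *ᵥ u = u i • (1 - firstPeriod p) := by
    ext k
    rw [Fmat_mulVec]
    by_cases hk : (k : ℕ) = 0 <;> simp [hk, firstPeriod]
  have hsum : (∑ j : Fin p, if (j : ℕ) < m + 1 then firstPeriod p j else 0) = 1 := by
    rw [Finset.sum_eq_single ⟨0, m.pos⟩]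
    · simp [firstPeriod]
    · intro j _ hj
      have : (j : ℕ) ≠ 0 := fun e => hj (Fin.ext e)
      simp [firstPeriod, this]
    · simp
  have e := key fun _ => i
  rw [hFc, mulVec_smul, mulVec_sub, Amat_mulVec_one, Pi.smul_apply, Pi.sub_apply, hrow, hsum,
    firstPeriod, if_neg (by omega)] at e
  rw [← e]
  have : ((m : ℕ) + 1 : ℝ) ≠ 0 := by positivity
  push_cast
  simp
  field_simp

end

section

theorem exists_isGInv {t : ℕ} (C : Matrix (Fin t) (Fin t) ℝ) : ∃ W, IsGInv C W := by
  obtain ⟨g, hg⟩ := (toLin' C).rangeRestrict.exists_rightInverse_of_surjective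
    (LinearMap.range_rangeRestrict _)
  obtain ⟨g', hg'⟩ := g.exists_extend
  refine ⟨LinearMap.toMatrix' g', ?_⟩
  refine Matrix.ext_of_mulVec_single fun j => ?_
  set v : Fin t → ℝ := Pi.single j 1
  rw [← mulVec_mulVec, ← mulVec_mulVec, LinearMap.toMatrix'_mulVec]
  have h1 := LinearMap.congr_fun hg' ((toLin' C).rangeRestrict v)
  have h2 := congrArg Subtype.val (LinearMap.congr_fun hg ((toLin' C).rangeRestrict v))
  have h1' : g' (C *ᵥ v) = g ((toLin' C).rangeRestrict v) := h1
  rw [h1']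
  exact h2

theorem permMat_conj {t : ℕ} (σ : Equiv.Perm (Fin t)) (M : Matrix (Fin t) (Fin t) ℝ) :
    (permMat t σ)ᵀ * M * permMat t σ = M.submatrix σ σ := by
  ext i j
  simp [permMat, Matrix.mul_apply]

theorem trace_submatrix_perm {t : ℕ} (σ : Equiv.Perm (Fin t)) (M : Matrix (Fin t) (Fin t) ℝ) :
    (M.submatrix σ σ).trace = M.trace :=
  Equiv.sum_comp σ fun i => M i i

theorem isCriterion_trace (t : ℕ) : IsCriterion t trace := by
  refine ⟨fun lam _ _ M N _ _ => ?_, fun σ M => ?_, fun M hM b c _ hbc => ?_⟩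
  · simp
  · rw [permMat_conj, trace_submatrix_perm]
  · simp only [trace_smul, smul_eq_mul]
    exact mul_le_mul_of_nonneg_right hbc hM.trace_nonneg

variable {p t n : ℕ} {a : ℕ → ℝ} {P : (Fin p → Fin t) → ℝ}

/-- Otherwise the trace of `C(Q)` could be made arbitrarily large by the choice of the generalized
inverse. -/
theorem IsUnivOptimal.C12_mulVec_eq_zero (hopt : IsUnivOptimal p t n a P)
    {Q : (Fin p → Fin t) → ℝ} (hQ : IsDesign Q) {u : Fin t → ℝ}
    (hu : C22 p t n a Q *ᵥ u = 0) : C12 p t n a Q *ᵥ u = 0 := by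
  obtain ⟨WP, hWP⟩ := exists_isGInv (C22 p t n a P)
  obtain ⟨WQ, hWQ⟩ := exists_isGInv (C22 p t n a Q)
  set N := C12 p t n a Q
  by_contra hne
  have hpos : 0 < (N *ᵥ u) ⬝ᵥ (N *ᵥ u) := by
    rw [← star_trivial (N *ᵥ u)]
    simpa using dotProduct_star_self_pos_iff.2 hne
  have key : ∀ c : ℝ, (CInfo p t n a Q WQ).trace + c * ((N *ᵥ u) ⬝ᵥ (N *ᵥ u)) ≤
      (CInfo p t n a P WP).trace := by
    intro c
    have hW : IsGInv (C22 p t n a Q) (WQ + (-c) • vecMulVec u u) := by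
      unfold IsGInv at *
      rw [Matrix.mul_add, Matrix.add_mul, hWQ, Matrix.mul_smul, mul_vecMulVec, hu]
      simp
    have e := hopt trace (isCriterion_trace t) Q hQ WP _ hWP hW
    refine le_trans (le_of_eq ?_) e
    rw [CInfo, CInfo, Matrix.mul_add, Matrix.add_mul, Matrix.mul_smul, mul_vecMulVec,
      Matrix.smul_mul, vecMulVec_mul, vecMul_transpose]
    simp only [trace_sub, trace_add, trace_smul, trace_vecMulVec, smul_eq_mul]
    ring
  have := key (((CInfo p t n a P WP).trace - (CInfo p t n a Q WQ).trace + 1) /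
    ((N *ᵥ u) ⬝ᵥ (N *ᵥ u)))
  rw [div_mul_cancel₀ _ hpos.ne'] at this
  linarith

/-- A family of functions on a compact set that starts positive and cannot acquire a zero while
nonnegative stays nonnegative. -/
theorem nonneg_of_path {V : Type*} [TopologicalSpace V] {S : Set V} (hS : IsCompact S)
    {φ : ℝ × V → ℝ} (hφ : Continuous φ) (h0 : ∀ u ∈ S, 0 < φ (0, u))
    (h : ∀ s ∈ Set.Ico (0 : ℝ) 1, (∀ u ∈ S, 0 ≤ φ (s, u)) → ∀ u ∈ S, φ (s, u) ≠ 0) :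
    ∀ u ∈ S, 0 ≤ φ (1, u) := by
  by_contra! hcon
  obtain ⟨v, hv, hv1⟩ := hcon
  have hT : IsCompact ((Set.Icc (0 : ℝ) 1 ×ˢ S) ∩ {x | φ x ≤ 0}) :=
    (isCompact_Icc.prod hS).inter_right (isClosed_le hφ continuous_const)
  obtain ⟨⟨s₀, u₀⟩, ⟨⟨hs₀, hu₀⟩, hle⟩, hmin⟩ := hT.exists_isMinOn
    ⟨(1, v), ⟨⟨by simp, hv⟩, hv1.le⟩⟩ continuous_fst.continuousOn
  simp only [Set.mem_ofPred_eq] at hs₀ hu₀ hle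
  have hs₀pos : 0 < s₀ := lt_of_le_of_ne hs₀.1 fun e => by
    subst e; exact absurd (h0 u₀ hu₀) (not_lt.2 hle)
  have hnn : ∀ u ∈ S, 0 ≤ φ (s₀, u) := by
    intro u hu
    have hc : Continuous fun s : ℝ => φ (s, u) := by fun_prop
    have hlim : Filter.Tendsto (fun s => φ (s, u)) (nhdsWithin s₀ (Set.Iio s₀))
        (nhds (φ (s₀, u))) := hc.continuousWithinAt.tendsto
    refine ge_of_tendsto hlim ?_
    filter_upwards [Ioo_mem_nhdsLT hs₀pos] with s hs
    by_contra! hneg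
    have := hmin (a := (s, u)) ⟨⟨⟨hs.1.le, hs.2.le.trans hs₀.2⟩, hu⟩, hneg.le⟩
    exact absurd hs.2 (not_lt.2 this)
  rcases lt_or_eq_of_le hs₀.2 with hlt | rfl
  · exact h s₀ ⟨hs₀.1, hlt⟩ hnn u₀ hu₀ (le_antisymm hle (hnn u₀ hu₀))
  · exact absurd hv1 (not_lt.2 (hnn v hv))

theorem isCompact_unit_contrasts (t : ℕ) :
    IsCompact {u : Fin t → ℝ | u ⬝ᵥ u = 1 ∧ (1 : Fin t → ℝ) ⬝ᵥ u = 0} := by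
  refine Metric.isCompact_of_isClosed_isBounded ?_ ?_
  · refine (isClosed_eq ?_ continuous_const).inter (isClosed_eq ?_ continuous_const) <;> fun_prop
  · refine (Metric.isBounded_closedBall (x := (0 : Fin t → ℝ)) (r := 1)).subset ?_
    rintro u ⟨hu, -⟩
    rw [mem_closedBall_zero_iff, pi_norm_le_iff_of_nonneg zero_le_one]
    intro i
    rw [Real.norm_eq_abs, abs_le_one_iff_mul_self_le_one, ← hu]
    exact Finset.single_le_sum (f := fun i => u i * u i) (fun j _ => mul_self_nonneg (u j))
      (Finset.mem_univ i)

theorem posSemidef_of_unit_contrasts {t : ℕ} {K : Matrix (Fin t) (Fin t) ℝ} (hK : Kᵀ = K)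
    (h1 : K *ᵥ 1 = 0)
    (h : ∀ u : Fin t → ℝ, u ⬝ᵥ u = 1 → (1 : Fin t → ℝ) ⬝ᵥ u = 0 → 0 ≤ u ⬝ᵥ (K *ᵥ u)) :
    K.PosSemidef := by
  refine PosSemidef.of_dotProduct_mulVec_nonneg ?_ fun v => ?_
  · rw [IsHermitian, conjTranspose_eq_transpose_of_trivial, hK]
  · rw [star_trivial]
    have h1' : (1 : Fin t → ℝ) ᵥ* K = 0 := by rw [← mulVec_transpose, hK, h1]
    set w := Bsq t *ᵥ v with hw
    have hv : v = w + ((t : ℝ)⁻¹ * (1 ⬝ᵥ v)) • 1 := by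
      rw [hw, Bsq_eq, sub_mulVec, one_mulVec, smul_mulVec, vecMulVec_mulVec]
      ext i; simp
    have e : v ⬝ᵥ (K *ᵥ v) = w ⬝ᵥ (K *ᵥ w) := by
      conv_lhs => rw [hv]
      rw [mulVec_add, mulVec_smul, h1, smul_zero, add_zero, add_dotProduct, smul_dotProduct,
        dotProduct_mulVec 1, h1', zero_dotProduct, smul_zero, add_zero]
    have hw1 : (1 : Fin t → ℝ) ⬝ᵥ w = 0 := by
      rw [hw, dotProduct_mulVec, ← mulVec_transpose, Bsq_transpose, Bsq_mulVec_one,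
        zero_dotProduct]
    rw [e]
    rcases eq_or_ne w 0 with h0 | h0
    · simp [h0]
    · have hpos : 0 < w ⬝ᵥ w := by simpa using dotProduct_star_self_pos_iff.2 h0
      set r := Real.sqrt (w ⬝ᵥ w)
      have hr : 0 < r := Real.sqrt_pos.2 hpos
      have hrr : r * r = w ⬝ᵥ w := Real.mul_self_sqrt hpos.le
      have := h (r⁻¹ • w) (by
        rw [smul_dotProduct, dotProduct_smul, ← hrr, smul_eq_mul, smul_eq_mul]
        field_simp) (by rw [dotProduct_smul, hw1, smul_zero])
      rw [mulVec_smul, smul_dotProduct, dotProduct_smul, smul_eq_mul, smul_eq_mul, ← mul_assoc]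
        at this
      exact nonneg_of_mul_nonneg_right this (by positivity)

theorem continuous_C22 (p t n : ℕ) (a : ℕ → ℝ) : Continuous (C22 p t n a) := by
  unfold C22 Fbar
  fun_prop

theorem posSemidef_elimOnes_C22 (h : IsDropoutDist p a) (hn : 1 ≤ n) (ht : 2 ≤ t)
    (h12 : ∀ Q : (Fin p → Fin t) → ℝ, IsDesign Q → ∀ u : Fin t → ℝ,
      C22 p t n a Q *ᵥ u = 0 → C12 p t n a Q *ᵥ u = 0)
    {U : (Fin p → Fin t) → ℝ} (hU : IsDesign U) (hUpos : ∀ s, 0 < U s)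
    (hUK : ∀ u : Fin t → ℝ, u ⬝ᵥ u = 1 → (1 : Fin t → ℝ) ⬝ᵥ u = 0 →
      0 < u ⬝ᵥ (elimOnes (C22 p t n a U) *ᵥ u))
    (hP : IsDesign P) : (elimOnes (C22 p t n a P)).PosSemidef := by
  set Q : ℝ → (Fin p → Fin t) → ℝ := fun s => (1 - s) • U + s • P with hQdef
  have hQ : ∀ s ∈ Set.Icc (0 : ℝ) 1, IsDesign (Q s) := by
    intro s hs
    refine ⟨fun x => ?_, ?_⟩
    · exact add_nonneg (mul_nonneg (by linarith [hs.2]) (hU.1 x)) (mul_nonneg hs.1 (hP.1 x))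
    · simp only [hQdef, Pi.add_apply, Pi.smul_apply, smul_eq_mul, Finset.sum_add_distrib,
        ← Finset.mul_sum, hU.2, hP.2]
      ring
  have hsymm : ∀ s, (elimOnes (C22 p t n a (Q s)))ᵀ = elimOnes (C22 p t n a (Q s)) :=
    fun s => elimOnes_transpose (C22_transpose _ _ _ _ _)
  have hone : ∀ s ∈ Set.Icc (0 : ℝ) 1, elimOnes (C22 p t n a (Q s)) *ᵥ 1 = 0 := fun s hs =>
    elimOnes_mulVec_one (C22_mulVec_one_eq_zero h hn (hQ s hs))
  set ρ := -(n * (firstPeriod p ⬝ᵥ ((Bmat p n a - Amat p n a) *ᵥ firstPeriod p))) with hρ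
  set K : ℝ → Matrix (Fin t) (Fin t) ℝ := fun s => C22 p t n a (Q s) -
    ρ⁻¹ • vecMulVec (C22 p t n a (Q s) *ᵥ 1) (C22 p t n a (Q s) *ᵥ 1) with hKdef
  have hK : ∀ s ∈ Set.Icc (0 : ℝ) 1, K s = elimOnes (C22 p t n a (Q s)) := by
    intro s hs
    rw [elimOnes, one_dotProduct_C22_mulVec_one (hQ s hs)]
  have hKc : Continuous K := by
    have : Continuous fun s => C22 p t n a (Q s) := (continuous_C22 p t n a).comp (by fun_prop)
    simp only [hKdef]
    fun_prop
  have hφ : Continuous fun x : ℝ × (Fin t → ℝ) => x.2 ⬝ᵥ (K x.1 *ᵥ x.2) := by fun_prop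
  have h01 : (1 : ℝ) ∈ Set.Icc (0 : ℝ) 1 := by simp
  have h00 : (0 : ℝ) ∈ Set.Icc (0 : ℝ) 1 := by simp
  have hQ1 : Q 1 = P := by simp [hQdef]
  have hQ0 : Q 0 = U := by simp [hQdef]
  have key := nonneg_of_path (isCompact_unit_contrasts t) hφ
    (fun u hu => by
      simp only [hK 0 h00, hQ0]
      exact hUK u hu.1 hu.2) fun s hs hnn u hu hzero => by
    have hs' : s ∈ Set.Icc (0 : ℝ) 1 := Set.Ico_subset_Icc_self hs
    simp only [hK s hs'] at hnn hzero
    have hps := posSemidef_of_unit_contrasts (hsymm s) (hone s hs') fun v h1 h2 => hnn v ⟨h1, h2⟩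
    obtain ⟨c, hc⟩ := exists_mulVec_add_eq_zero
      ((hps.dotProduct_mulVec_zero_iff u).1 (by rwa [star_trivial]))
    obtain ⟨d, hd⟩ := eq_const_of_C22_mulVec_eq_zero h hn ht h12 (hQ s hs')
      (fun x => add_pos_of_pos_of_nonneg (mul_pos (by linarith [hs.2]) (hUpos x))
        (mul_nonneg hs.1 (hP.1 x))) hc
    have hu' : u = (d - c) • 1 := by rw [sub_smul, ← hd]; simp
    have : u ⬝ᵥ u = 0 := by
      conv_lhs => enter [1]; rw [hu']
      rw [smul_dotProduct, hu.2, smul_zero]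
    rw [hu.1] at this
    exact one_ne_zero this
  rw [← hQ1]
  refine posSemidef_of_unit_contrasts (hsymm 1) (hone 1 h01) fun u h1 h2 => ?_
  have := key u ⟨h1, h2⟩
  rwa [hK 1 h01] at this

theorem trace_CInfo_le (h : IsDropoutDist p a) (hn : 1 ≤ n) (hP : IsDesign P)
    (h12 : ∀ u : Fin t → ℝ, C22 p t n a P *ᵥ u = 0 → C12 p t n a P *ᵥ u = 0)
    (hK : (elimOnes (C22 p t n a P)).PosSemidef)
    {W : Matrix (Fin t) (Fin t) ℝ} (hW : IsGInv (C22 p t n a P) W) (x : ℝ) :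
    (CInfo p t n a P W).trace ≤ n * ∑ s, P s * qfun p t n a s x := by
  have h1 := C22_mulVec_one_eq_zero (t := t) h hn hP
  have hle := fun w => trace_info_le h hn hP x w rfl
  have hC := C22_transpose p t n a P
  rw [CInfo]
  unfold IsGInv at hW
  set C := C22 p t n a P
  set N := C12 p t n a P
  set r : Fin t → ℝ := C *ᵥ 1 with hr
  have hNWC : N * W * C = N := by
    refine Matrix.ext_of_mulVec_single fun j => ?_
    set v : Fin t → ℝ := Pi.single j 1
    have := h12 (W *ᵥ (C *ᵥ v) - v) (by
      rw [mulVec_sub, mulVec_mulVec, mulVec_mulVec, hW, sub_self])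
    rw [mulVec_sub, sub_eq_zero, mulVec_mulVec, mulVec_mulVec] at this
    exact this
  have hCWN : C * (N * W)ᵀ = Nᵀ := by
    conv_rhs => rw [← hNWC]
    rw [transpose_mul (N * W), hC]
  set Z := N * W with hZ
  set v := (x • Bsq t + Zᵀ)ᵀ *ᵥ r with hv
  set w := -((1 : Fin t → ℝ) ⬝ᵥ r)⁻¹ • v with hw
  set X := x • Bsq t + vecMulVec (1 : Fin t → ℝ) w with hX
  have hYr : (X + Zᵀ)ᵀ *ᵥ r = 0 := by
    have : X + Zᵀ = (x • Bsq t + Zᵀ) + vecMulVec (1 : Fin t → ℝ) w := by rw [hX]; abel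
    rw [this, transpose_add, add_mulVec, ← hv, transpose_vecMulVec, vecMulVec_mulVec]
    by_cases h0 : (1 : Fin t → ℝ) ⬝ᵥ r = 0
    · have : v = 0 := by rw [hv, h1 h0, mulVec_zero]
      simp [hw, this]
    · ext i
      simp only [hw, Pi.add_apply, Pi.smul_apply, MulOpposite.smul_eq_mul_unop,
        MulOpposite.unop_op, Pi.zero_apply, smul_eq_mul]
      field_simp
      ring
  have hnn : 0 ≤ ((X + Zᵀ)ᵀ * C * (X + Zᵀ)).trace := by
    have e := (hK.conjTranspose_mul_mul_same (X + Zᵀ)).trace_nonneg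
    rw [conjTranspose_eq_transpose_of_trivial, elimOnes, Matrix.mul_sub, Matrix.sub_mul,
      Matrix.mul_smul, mul_vecMulVec, hYr] at e
    simpa using e
  have hsplit : C11 p t n a P + N * X + Xᵀ * Nᵀ + Xᵀ * C * X =
      (C11 p t n a P - Z * Nᵀ) + (X + Zᵀ)ᵀ * C * (X + Zᵀ) := by
    simp only [transpose_add, transpose_transpose, Matrix.add_mul, Matrix.mul_add, hNWC,
      Matrix.mul_assoc Xᵀ C Zᵀ, hCWN]
    rw [show N * Zᵀ = Z * Nᵀ by rw [← hCWN, ← Matrix.mul_assoc, hNWC]]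
    abel
  have := hle w
  rw [hsplit, trace_add] at this
  linarith

end

section

theorem one_vecMul_Bsq (t : ℕ) : (1 : Fin t → ℝ) ᵥ* Bsq t = 0 := by
  rw [← mulVec_transpose, Bsq_transpose, Bsq_mulVec_one]

theorem trace_Bsq {t : ℕ} (ht : 2 ≤ t) : (Bsq t).trace = (t : ℝ) - 1 := by
  have : (t : ℝ) ≠ 0 := by exact_mod_cast (by omega : t ≠ 0)
  rw [Bsq_eq, trace_sub, trace_smul, trace_vecMulVec]
  simp [this]

theorem exists_perm_apply {α : Type*} [DecidableEq α] {x y i j : α} (hxy : x ≠ y) (hij : i ≠ j) :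
    ∃ σ : Equiv.Perm α, σ x = i ∧ σ y = j := by
  refine ⟨Equiv.swap (Equiv.swap x i y) j * Equiv.swap x i, ?_, ?_⟩
  · have : i ≠ Equiv.swap x i y := fun e => hxy <| (Equiv.swap x i).injective <| by simpa using e
    simp [Equiv.swap_apply_of_ne_of_ne this hij]
  · simp

theorem exists_eq_of_submatrix_perm {t : ℕ} (ht : 2 ≤ t) {M : Matrix (Fin t) (Fin t) ℝ}
    (h : ∀ σ : Equiv.Perm (Fin t), M.submatrix σ σ = M) :
    ∃ x y : ℝ, M = x • Bsq t + y • vecMulVec 1 1 := by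
  set z : Fin t := ⟨0, by omega⟩
  set o : Fin t := ⟨1, by omega⟩
  have hzo : z ≠ o := by simp [z, o]
  refine ⟨M z z - M z o, M z o + (M z z - M z o) * (t : ℝ)⁻¹, ?_⟩
  ext i j
  rcases eq_or_ne i j with rfl | hij
  · have := congrFun₂ (h (Equiv.swap z i)) z z
    simp only [submatrix_apply, Equiv.swap_apply_left] at this
    rw [this]
    simp [Bsq_eq]
    ring
  · obtain ⟨σ, hσ1, hσ2⟩ := exists_perm_apply hzo hij
    have := congrFun₂ (h σ) z o
    rw [submatrix_apply, hσ1, hσ2] at this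
    rw [this]
    simp [Bsq_eq, Matrix.one_apply_ne hij]

theorem trace_smul_Bsq_add_mul_Bsq {t : ℕ} (ht : 2 ≤ t) (x y : ℝ) :
    ((x • Bsq t + y • vecMulVec 1 1) * Bsq t).trace = x * ((t : ℝ) - 1) := by
  rw [Matrix.add_mul, Matrix.smul_mul, Matrix.smul_mul, Bsq_mul_Bsq, vecMulVec_mul, one_vecMul_Bsq,
    vecMulVec_zero, smul_zero, add_zero, trace_smul, trace_Bsq ht, smul_eq_mul]

theorem eq_zero_of_mulVec_one_eq_zero {t : ℕ} (ht : 2 ≤ t) {x y : ℝ}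
    (h : (x • Bsq t + y • vecMulVec 1 1) *ᵥ 1 = 0) : y = 0 := by
  have ht' : (t : ℝ) ≠ 0 := by exact_mod_cast (by omega : t ≠ 0)
  rw [add_mulVec, smul_mulVec, Bsq_mulVec_one, smul_mulVec, vecMulVec_mulVec] at h
  have := congrFun h ⟨0, by omega⟩
  simpa [ht'] using this

section Symmetric

variable {p t : ℕ}

theorem Bsq_submatrix_perm (σ : Equiv.Perm (Fin t)) : (Bsq t).submatrix σ σ = Bsq t := by
  ext i j
  simp [Bsq_eq, Matrix.one_apply]

theorem sum_comp_perm {M : Type*} [AddCommMonoid M] (σ : Equiv.Perm (Fin t))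
    (f : (Fin p → Fin t) → M) : ∑ s : Fin p → Fin t, f (fun k => σ (s k)) = ∑ s, f s :=
  Equiv.sum_comp ((Equiv.refl (Fin p)).arrowCongr σ) f

theorem IsSymmetricDesign.sum_submatrix {S : (Fin p → Fin t) → ℝ} (hS : IsSymmetricDesign S)
    {m : Type*} (r : m → m) (σ : Equiv.Perm (Fin t)) {K : (Fin p → Fin t) → Matrix m (Fin t) ℝ}
    (hK : ∀ s, (K fun k => σ (s k)).submatrix r σ = K s) :
    (∑ s, S s • K s).submatrix r σ = ∑ s, S s • K s := by
  have e : ∀ L : (Fin p → Fin t) → Matrix m (Fin t) ℝ,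
      (∑ s, L s).submatrix r σ = ∑ s, (L s).submatrix r σ := fun L => by
    ext i j
    simp [Matrix.sum_apply]
  conv_lhs => rw [← sum_comp_perm σ fun s => S s • K s, e]
  refine Finset.sum_congr rfl fun s _ => ?_
  rw [hS σ, ← hK s]
  rfl

/-- The common shape of the matrices `C₁₁`, `C₁₂` and `C₂₂`. -/
def centeredForm (A B : Matrix (Fin p) (Fin p) ℝ) (S : (Fin p → Fin t) → ℝ)
    (G H : (Fin p → Fin t) → Matrix (Fin p) (Fin t) ℝ) : Matrix (Fin t) (Fin t) ℝ :=
  ∑ s, S s • ((G s)ᵀ * A * H s) - (∑ s, S s • G s)ᵀ * B * ∑ s, S s • H s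

/-- A family of matrices indexed by sequences that commutes with the relabelling of treatments. -/
def IsEquivariant (G : (Fin p → Fin t) → Matrix (Fin p) (Fin t) ℝ) : Prop :=
  ∀ (σ : Equiv.Perm (Fin t)) s, (G fun k => σ (s k)).submatrix id σ = G s

variable {S : (Fin p → Fin t) → ℝ} {G H : (Fin p → Fin t) → Matrix (Fin p) (Fin t) ℝ}

theorem transpose_mul_mul_submatrix (A : Matrix (Fin p) (Fin p) ℝ) (X Y : Matrix (Fin p) (Fin t) ℝ)
    (σ : Equiv.Perm (Fin t)) :
    (Xᵀ * A * Y).submatrix σ σ = (X.submatrix id σ)ᵀ * A * Y.submatrix id σ := by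
  ext i j
  simp [Matrix.mul_apply]

theorem IsEquivariant.transpose_mul_mul (hG : IsEquivariant G) (hH : IsEquivariant H)
    (A : Matrix (Fin p) (Fin p) ℝ) (σ : Equiv.Perm (Fin t)) (s : Fin p → Fin t) :
    ((G fun k => σ (s k))ᵀ * A * H fun k => σ (s k)).submatrix σ σ = (G s)ᵀ * A * H s := by
  rw [transpose_mul_mul_submatrix, hG, hH]

theorem IsEquivariant.centeredForm_submatrix (hG : IsEquivariant G) (hH : IsEquivariant H)
    (hS : IsSymmetricDesign S) (A B : Matrix (Fin p) (Fin p) ℝ) (σ : Equiv.Perm (Fin t)) :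
    (centeredForm A B S G H).submatrix σ σ = centeredForm A B S G H := by
  rw [centeredForm, submatrix_sub, Pi.sub_apply, Pi.sub_apply, transpose_mul_mul_submatrix,
    hS.sum_submatrix id σ (hG σ), hS.sum_submatrix id σ (hH σ),
    hS.sum_submatrix σ σ (hG.transpose_mul_mul hH A σ)]

theorem IsEquivariant.sum_smul_mul_Bsq (hH : IsEquivariant H) (hS : IsSymmetricDesign S) :
    (∑ s, S s • H s) * Bsq t = 0 := by
  rcases isEmpty_or_nonempty (Fin t) with _ | ⟨⟨i⟩⟩
  · ext k j
    exact isEmptyElim j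
  · obtain ⟨w, hw⟩ : ∃ w, ∑ s, S s • H s = vecMulVec w 1 := by
      refine ⟨fun k => (∑ s, S s • H s) k i, ?_⟩
      ext k j
      have := congrFun₂ (hS.sum_submatrix id (Equiv.swap i j) (hH (Equiv.swap i j))) k i
      rw [submatrix_apply, Equiv.swap_apply_left] at this
      rw [id] at this
      simp [vecMulVec_apply, this]
    rw [hw, vecMulVec_mul, one_vecMul_Bsq]
    ext k j
    simp [vecMulVec_apply]

theorem IsEquivariant.trace_centeredForm_mul_Bsq (hH : IsEquivariant H)
    (hS : IsSymmetricDesign S) (A B : Matrix (Fin p) (Fin p) ℝ) :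
    (centeredForm A B S G H * Bsq t).trace =
      ∑ s, S s * (Bsq t * (G s)ᵀ * A * H s * Bsq t).trace := by
  rw [centeredForm, Matrix.sub_mul, Matrix.mul_assoc _ _ (Bsq t), hH.sum_smul_mul_Bsq hS,
    Matrix.mul_zero, sub_zero, Matrix.sum_mul, trace_sum]
  refine Finset.sum_congr rfl fun s _ => ?_
  rw [Matrix.smul_mul, trace_smul, smul_eq_mul, Matrix.trace_mul_comm _ (Bsq t)]
  congr 1
  conv_lhs => rw [← Bsq_mul_Bsq, Matrix.mul_assoc, Matrix.trace_mul_comm]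
  simp only [Matrix.mul_assoc]

theorem isEquivariant_Tmat : IsEquivariant (Tmat : (Fin p → Fin t) → _) := fun σ s => by
  ext k i
  simp [Tmat]

theorem isEquivariant_Fmat : IsEquivariant (Fmat : (Fin p → Fin t) → _) := fun σ s => by
  ext k i
  simp [Fmat]

theorem IsEquivariant.exists_centeredForm_eq (ht : 2 ≤ t) (hG : IsEquivariant G)
    (hH : IsEquivariant H) (hS : IsSymmetricDesign S) (A B : Matrix (Fin p) (Fin p) ℝ) :
    ∃ y : ℝ, centeredForm A B S G H =
      ((∑ s, S s * (Bsq t * (G s)ᵀ * A * H s * Bsq t).trace) / ((t : ℝ) - 1)) • Bsq t +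
        y • vecMulVec 1 1 := by
  have ht' : (t : ℝ) - 1 ≠ 0 := by
    have : (2 : ℝ) ≤ t := by exact_mod_cast ht
    linarith
  obtain ⟨x, y, h⟩ := exists_eq_of_submatrix_perm ht (hG.centeredForm_submatrix hH hS A B)
  refine ⟨y, ?_⟩
  rw [← hH.trace_centeredForm_mul_Bsq hS A B, h, trace_smul_Bsq_add_mul_Bsq ht,
    mul_div_cancel_right₀ _ ht']

theorem centeredForm_mulVec_one_of_Tmat {A B : Matrix (Fin p) (Fin p) ℝ} (hA : A *ᵥ 1 = 0)
    (hB : B *ᵥ 1 = 0) (hS : IsDesign S) : centeredForm A B S G Tmat *ᵥ 1 = 0 := by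
  have := Tbar_mulVec_one hS
  rw [Tbar] at this
  rw [centeredForm, sub_mulVec, ← mulVec_mulVec, this, ← mulVec_mulVec, hB, mulVec_zero,
    sub_zero, Matrix.sum_mulVec]
  refine Finset.sum_eq_zero fun s _ => ?_
  rw [smul_mulVec, ← mulVec_mulVec, Tmat_mulVec_one, ← mulVec_mulVec, hA, mulVec_zero, smul_zero]

theorem centeredForm_transpose {A B : Matrix (Fin p) (Fin p) ℝ} (hA : Aᵀ = A) (hB : Bᵀ = B) :
    (centeredForm A B S G H)ᵀ = centeredForm A B S H G := by
  simp [centeredForm, Matrix.transpose_sum, transpose_mul, hA, hB, Matrix.mul_assoc]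

variable {n : ℕ} {a : ℕ → ℝ}

theorem C11_eq_of_symmetric (ht : 2 ≤ t) (hS : IsDesign S) (hS' : IsSymmetricDesign S) :
    C11 p t n a S = ((n : ℝ) * ((∑ s, S s * q11 p t n a s) / ((t : ℝ) - 1))) • Bsq t := by
  obtain ⟨y, hy⟩ := isEquivariant_Tmat.exists_centeredForm_eq ht isEquivariant_Tmat hS'
    (Amat p n a) (Bmat p n a)
  have h1 := centeredForm_mulVec_one_of_Tmat (G := Tmat) (Amat_mulVec_one p n a)
    (Bmat_mulVec_one p n a) hS
  rw [hy] at h1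
  rw [eq_zero_of_mulVec_one_eq_zero ht h1, zero_smul, add_zero] at hy
  rw [mul_smul]
  exact congrArg ((n : ℝ) • ·) hy

theorem C12_eq_of_symmetric (ht : 2 ≤ t) (hS : IsDesign S) (hS' : IsSymmetricDesign S) :
    C12 p t n a S = ((n : ℝ) * ((∑ s, S s * q12 p t n a s) / ((t : ℝ) - 1))) • Bsq t := by
  obtain ⟨y, hy⟩ := isEquivariant_Tmat.exists_centeredForm_eq ht isEquivariant_Fmat hS'
    (Amat p n a) (Bmat p n a)
  have h1 := centeredForm_mulVec_one_of_Tmat (G := Fmat) (Amat_mulVec_one p n a)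
    (Bmat_mulVec_one p n a) hS
  rw [← centeredForm_transpose (Amat_transpose p n a) (Bmat_transpose p n a), hy, transpose_add,
    transpose_smul, transpose_smul, Bsq_transpose, transpose_vecMulVec] at h1
  rw [eq_zero_of_mulVec_one_eq_zero ht h1, zero_smul, add_zero] at hy
  rw [mul_smul]
  exact congrArg ((n : ℝ) • ·) hy

theorem exists_C22_eq_of_symmetric (ht : 2 ≤ t) (hS' : IsSymmetricDesign S) :
    ∃ y : ℝ, C22 p t n a S =
      ((n : ℝ) * ((∑ s, S s * q22 p t n a s) / ((t : ℝ) - 1))) • Bsq t + y • vecMulVec 1 1 := by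
  obtain ⟨y, hy⟩ := isEquivariant_Fmat.exists_centeredForm_eq ht isEquivariant_Fmat hS'
    (Amat p n a) (Bmat p n a)
  refine ⟨n * y, ?_⟩
  rw [mul_smul, mul_smul, ← smul_add]
  exact congrArg ((n : ℝ) • ·) hy

theorem trace_transpose_mul_mul_eq_sum (A : Matrix (Fin p) (Fin p) ℝ)
    (G : Matrix (Fin p) (Fin t) ℝ) :
    (Gᵀ * A * G).trace = ∑ i, (fun k => G k i) ⬝ᵥ (A *ᵥ fun k => G k i) := by
  refine Finset.sum_congr rfl fun i _ => ?_
  rw [Matrix.mul_assoc]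
  rfl

theorem q22_pos (h : IsDropoutDist p a) (hn : 1 ≤ n) (hp : 2 ≤ p) (ht : 2 ≤ t)
    (s : Fin p → Fin t) : 0 < q22 p t n a s := by
  obtain ⟨c, hc, hle⟩ := h.exists_mul_sq_le hn hp
  have e : q22 p t n a s = ((Fmat s * Bsq t)ᵀ * Amat p n a * (Fmat s * Bsq t)).trace := by
    rw [q22, transpose_mul, Bsq_transpose]
    simp only [Matrix.mul_assoc]
  rw [e, trace_transpose_mul_mul_eq_sum]
  have hnn : ∀ f : Fin p → ℝ, 0 ≤ f ⬝ᵥ (Amat p n a *ᵥ f) := fun f =>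
    (by positivity : (0 : ℝ) ≤ _).trans (hle f)
  refine Finset.sum_pos' (fun i _ => hnn _) ⟨s ⟨0, by omega⟩, Finset.mem_univ _, ?_⟩
  refine lt_of_lt_of_le ?_ (hle _)
  have hF : ∀ k i, (Fmat s * Bsq t) k i = (Fmat s *ᵥ fun j => Bsq t j i) k := fun _ _ => rfl
  have ht' : (t : ℝ)⁻¹ < 1 := inv_lt_one_of_one_lt₀ (by exact_mod_cast (by omega : 1 < t))
  have h0 : (Fmat s * Bsq t) ⟨0, by omega⟩ (s ⟨0, by omega⟩) = 0 := by
    rw [hF, Fmat_mulVec, if_pos rfl]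
  have h1 : (Fmat s * Bsq t) ⟨1, hp⟩ (s ⟨0, by omega⟩) = 1 - (t : ℝ)⁻¹ := by
    rw [hF, Fmat_mulVec, if_neg one_ne_zero]
    simp [Bsq_eq]
  rw [h0, h1, zero_sub, neg_sq]
  exact mul_pos hc (pow_pos (by linarith) 2)

theorem sum_mul_q22_pos (h : IsDropoutDist p a) (hn : 1 ≤ n) (hp : 2 ≤ p) (ht : 2 ≤ t)
    (hS : IsDesign S) : 0 < ∑ s, S s * q22 p t n a s := by
  have hnn : ∀ s, 0 ≤ S s * q22 p t n a s := fun s => mul_nonneg (hS.1 s) (q22_pos h hn hp ht s).le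
  refine lt_of_le_of_ne (Finset.sum_nonneg fun s _ => hnn s) fun e => ?_
  have h0 := (Finset.sum_eq_zero_iff_of_nonneg fun s _ => hnn s).1 e.symm
  have : ∑ s, S s = 0 := Finset.sum_eq_zero fun s hs =>
    (mul_eq_zero.1 (h0 s hs)).resolve_right (q22_pos h hn hp ht s).ne'
  rw [hS.2] at this
  exact one_ne_zero this

theorem CInfo_eq_of_symmetric (h : IsDropoutDist p a) (hn : 1 ≤ n) (hp : 2 ≤ p) (ht : 2 ≤ t)
    (hS : IsDesign S) (hS' : IsSymmetricDesign S) {W : Matrix (Fin t) (Fin t) ℝ}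
    (hW : IsGInv (C22 p t n a S) W) :
    CInfo p t n a S W = ((n : ℝ) * (∑ s, S s * q11 p t n a s -
      (∑ s, S s * q12 p t n a s) ^ 2 / ∑ s, S s * q22 p t n a s) / ((t : ℝ) - 1)) • Bsq t := by
  have hpos := sum_mul_q22_pos h hn hp ht hS
  obtain ⟨y, hy⟩ := exists_C22_eq_of_symmetric (n := n) (a := a) ht hS'
  rw [CInfo, C11_eq_of_symmetric ht hS hS', C12_eq_of_symmetric ht hS hS']
  set Q₂₂ := ∑ s, S s * q22 p t n a s
  set Q₁₂ := ∑ s, S s * q12 p t n a s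
  have ht' : (0 : ℝ) < (t : ℝ) - 1 := by
    have : (2 : ℝ) ≤ t := by exact_mod_cast ht
    linarith
  have hn' : (0 : ℝ) < n := by exact_mod_cast hn
  set c := (n : ℝ) * (Q₂₂ / ((t : ℝ) - 1)) with hcdef
  have hc : 0 < c := by positivity
  have hCB : C22 p t n a S * Bsq t = c • Bsq t := by
    rw [hy, Matrix.add_mul, Matrix.smul_mul, Matrix.smul_mul, Bsq_mul_Bsq, vecMulVec_mul,
      one_vecMul_Bsq, vecMulVec_zero, smul_zero, add_zero]
  have hBC : Bsq t * C22 p t n a S = c • Bsq t := by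
    rw [← transpose_inj, transpose_mul, C22_transpose, Bsq_transpose, hCB, transpose_smul,
      Bsq_transpose]
  have hBWB : Bsq t * W * Bsq t = c⁻¹ • Bsq t := by
    have e : (c * c) • (Bsq t * W * Bsq t) = c • Bsq t := by
      calc (c * c) • (Bsq t * W * Bsq t) = (c • Bsq t) * W * (c • Bsq t) := by
            simp [mul_smul]
        _ = Bsq t * (C22 p t n a S * W * C22 p t n a S) * Bsq t := by
            rw [← hCB]
            conv_lhs => enter [1, 1]; rw [hCB, ← hBC]
            simp only [Matrix.mul_assoc]
        _ = c • Bsq t := by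
            rw [hW, hBC, Matrix.smul_mul, Bsq_mul_Bsq]
    rw [← inv_smul_smul₀ (mul_pos hc hc).ne' (Bsq t * W * Bsq t), e, smul_smul]
    congr 1
    field_simp
  rw [transpose_smul, Bsq_transpose, Matrix.smul_mul, Matrix.smul_mul, Matrix.mul_smul, hBWB,
    smul_smul, smul_smul, ← sub_smul]
  congr 1
  rw [hcdef]
  field_simp

theorem dotProduct_elimOnes_C22_of_symmetric (ht : 2 ≤ t) (hS' : IsSymmetricDesign S)
    {u : Fin t → ℝ} (hu : (1 : Fin t → ℝ) ⬝ᵥ u = 0) :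
    u ⬝ᵥ (elimOnes (C22 p t n a S) *ᵥ u) =
      (n : ℝ) * ((∑ s, S s * q22 p t n a s) / ((t : ℝ) - 1)) * (u ⬝ᵥ u) := by
  obtain ⟨y, hy⟩ := exists_C22_eq_of_symmetric (n := n) (a := a) ht hS'
  have hJ : ∀ v : Fin t → ℝ, vecMulVec (1 : Fin t → ℝ) 1 *ᵥ v = (1 ⬝ᵥ v) • 1 := fun v => by
    rw [vecMulVec_mulVec]
    ext i
    simp
  have hB : Bsq t *ᵥ u = u := by
    rw [Bsq_eq, sub_mulVec, one_mulVec, smul_mulVec, hJ, hu, zero_smul, smul_zero, sub_zero]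
  have h1 : (C22 p t n a S *ᵥ 1) ⬝ᵥ u = 0 := by
    rw [hy, add_mulVec, smul_mulVec, Bsq_mulVec_one, smul_mulVec, hJ, smul_zero, zero_add,
      smul_dotProduct, smul_dotProduct, hu, smul_zero, smul_zero]
  rw [elimOnes_mulVec, h1, mul_zero, zero_smul, sub_zero, hy, add_mulVec, smul_mulVec, hB,
    smul_mulVec, hJ, hu, zero_smul, smul_zero, add_zero, dotProduct_smul, smul_eq_mul]

end Symmetric

end

section

theorem Matrix.PosSemidef.abs_apply_le_trace {ι : Type*} [Fintype ι] [DecidableEq ι]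
    {M : Matrix ι ι ℝ} (hM : M.PosSemidef) (i j : ι) : |M i j| ≤ M.trace := by
  have hd : ∀ i, M i i ≤ M.trace := fun i =>
    Finset.single_le_sum (f := fun i => M i i) (fun j _ => hM.diag_nonneg) (Finset.mem_univ i)
  have hs : M j i = M i j := by simpa using hM.isHermitian.apply i j
  have h1 := hM.dotProduct_mulVec_nonneg (Pi.single i 1 + Pi.single j 1)
  have h2 := hM.dotProduct_mulVec_nonneg (Pi.single i 1 - Pi.single j 1)
  simp only [star_trivial, mulVec_add, mulVec_sub, mulVec_single_one, add_dotProduct,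
    sub_dotProduct, single_one_dotProduct, Pi.add_apply, Pi.sub_apply, col_apply] at h1 h2
  have := hd i
  have := hd j
  rw [abs_le]
  constructor <;> linarith

/-- The distance of `C` from the completely symmetric matrix with zero row sums and the same
trace. -/
def symmDeviation {t : ℕ} (C : Matrix (Fin t) (Fin t) ℝ) : ℝ :=
  ∑ i, ∑ j, |C i j - C.trace / ((t : ℝ) - 1) * Bsq t i j|

theorem symmDeviation_nonneg {t : ℕ} (C : Matrix (Fin t) (Fin t) ℝ) : 0 ≤ symmDeviation C :=
  Finset.sum_nonneg fun _ _ => Finset.sum_nonneg fun _ _ => abs_nonneg _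

theorem eq_of_symmDeviation_eq_zero {t : ℕ} {C : Matrix (Fin t) (Fin t) ℝ}
    (h : symmDeviation C = 0) : C = (C.trace / ((t : ℝ) - 1)) • Bsq t := by
  ext i j
  have h1 := (Finset.sum_eq_zero_iff_of_nonneg fun i _ =>
    Finset.sum_nonneg fun j _ => abs_nonneg _).1 h i (Finset.mem_univ i)
  have h2 := (Finset.sum_eq_zero_iff_of_nonneg fun j _ => abs_nonneg _).1 h1 j (Finset.mem_univ j)
  rw [abs_eq_zero, sub_eq_zero] at h2
  exact h2

theorem symmDeviation_smul_Bsq {t : ℕ} (ht : 2 ≤ t) (x : ℝ) : symmDeviation (x • Bsq t) = 0 := by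
  have ht' : (t : ℝ) - 1 ≠ 0 := by
    have : (2 : ℝ) ≤ t := by exact_mod_cast ht
    linarith
  refine Finset.sum_eq_zero fun i _ => Finset.sum_eq_zero fun j _ => ?_
  rw [trace_smul, trace_Bsq ht, smul_eq_mul, mul_div_cancel_right₀ _ ht', Matrix.smul_apply,
    smul_eq_mul, sub_self, abs_zero]

theorem symmDeviation_smul {t : ℕ} {b : ℝ} (hb : 0 ≤ b) (C : Matrix (Fin t) (Fin t) ℝ) :
    symmDeviation (b • C) = b * symmDeviation C := by
  simp only [symmDeviation, Finset.mul_sum]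
  refine Finset.sum_congr rfl fun i _ => Finset.sum_congr rfl fun j _ => ?_
  rw [← abs_of_nonneg hb, ← abs_mul, abs_of_nonneg hb, trace_smul, Matrix.smul_apply]
  simp only [smul_eq_mul]
  ring_nf

theorem symmDeviation_add_le {t : ℕ} (M N : Matrix (Fin t) (Fin t) ℝ) :
    symmDeviation (M + N) ≤ symmDeviation M + symmDeviation N := by
  simp only [symmDeviation, ← Finset.sum_add_distrib]
  refine Finset.sum_le_sum fun i _ => Finset.sum_le_sum fun j _ => ?_
  refine le_trans (le_of_eq ?_) (abs_add_le _ _)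
  rw [trace_add, Matrix.add_apply]
  ring_nf

theorem symmDeviation_submatrix {t : ℕ} (σ : Equiv.Perm (Fin t)) (M : Matrix (Fin t) (Fin t) ℝ) :
    symmDeviation (M.submatrix σ σ) = symmDeviation M := by
  simp only [symmDeviation, trace_submatrix_perm]
  conv_lhs => rw [← Bsq_submatrix_perm σ]
  simp only [submatrix_apply]
  rw [Equiv.sum_comp σ fun i => ∑ j, |M i (σ j) - M.trace / ((t : ℝ) - 1) * Bsq t i (σ j)|]
  exact Finset.sum_congr rfl fun i _ =>
    Equiv.sum_comp σ fun j => |M i j - M.trace / ((t : ℝ) - 1) * Bsq t i j|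

/-- A constant that bounds the deviation in terms of the trace. -/
def deviationBound (t : ℕ) : ℝ := 1 + ∑ i, ∑ j, (1 + |Bsq t i j| / ((t : ℝ) - 1))

theorem deviationBound_pos {t : ℕ} (ht : 2 ≤ t) : 0 < deviationBound t := by
  have ht' : (0 : ℝ) < (t : ℝ) - 1 := by
    have : (2 : ℝ) ≤ t := by exact_mod_cast ht
    linarith
  unfold deviationBound
  positivity

theorem symmDeviation_le {t : ℕ} (ht : 2 ≤ t) {M : Matrix (Fin t) (Fin t) ℝ} (hM : M.PosSemidef) :
    symmDeviation M ≤ deviationBound t * M.trace := by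
  have ht' : (0 : ℝ) < (t : ℝ) - 1 := by
    have : (2 : ℝ) ≤ t := by exact_mod_cast ht
    linarith
  rw [deviationBound, add_mul, Finset.sum_mul, one_mul]
  refine le_trans ?_ (le_add_of_nonneg_left hM.trace_nonneg)
  refine Finset.sum_le_sum fun i _ => ?_
  rw [Finset.sum_mul]
  refine Finset.sum_le_sum fun j _ => ?_
  refine (abs_sub _ _).trans ?_
  rw [abs_mul, abs_of_nonneg (div_nonneg hM.trace_nonneg ht'.le), add_mul, one_mul]
  refine add_le_add (hM.abs_apply_le_trace i j) (le_of_eq ?_)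
  ring

theorem isCriterion_trace_sub_symmDeviation {t : ℕ} (ht : 2 ≤ t) :
    IsCriterion t fun C => deviationBound t * C.trace - symmDeviation C := by
  refine ⟨fun lam h0 h1 M N _ _ => ?_, fun σ M => ?_, fun M hM b c hb hbc => ?_⟩
  · have := symmDeviation_add_le (lam • M) ((1 - lam) • N)
    rw [symmDeviation_smul h0, symmDeviation_smul (sub_nonneg.2 h1)] at this
    simp only [trace_add, trace_smul, smul_eq_mul]
    linarith
  · simp only [permMat_conj, trace_submatrix_perm, symmDeviation_submatrix]
  · have := mul_le_mul_of_nonneg_right hbc (sub_nonneg.2 (symmDeviation_le ht hM))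
    simp only [trace_smul, smul_eq_mul, symmDeviation_smul hb.le,
      symmDeviation_smul (hb.le.trans hbc)]
    linarith

variable {p t n : ℕ} {a : ℕ → ℝ} {P : (Fin p → Fin t) → ℝ}

/-- The value of `qmin` in closed form. -/
def qval (p t n : ℕ) (a : ℕ → ℝ) (P : (Fin p → Fin t) → ℝ) : ℝ :=
  ∑ s, P s * q11 p t n a s - (∑ s, P s * q12 p t n a s) ^ 2 / ∑ s, P s * q22 p t n a s

theorem sum_mul_qfun (p t n : ℕ) (a : ℕ → ℝ) (P : (Fin p → Fin t) → ℝ) (x : ℝ) :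
    ∑ s, P s * qfun p t n a s x = ∑ s, P s * q11 p t n a s + 2 * (∑ s, P s * q12 p t n a s) * x +
      (∑ s, P s * q22 p t n a s) * x ^ 2 := by
  simp only [Finset.mul_sum, Finset.sum_mul, ← Finset.sum_add_distrib, qfun]
  exact Finset.sum_congr rfl fun s _ => by ring

theorem exists_sum_mul_qfun_eq_qval (h : 0 < ∑ s, P s * q22 p t n a s) :
    ∃ x, ∑ s, P s * qfun p t n a s x = qval p t n a P := by
  refine ⟨-(∑ s, P s * q12 p t n a s) / ∑ s, P s * q22 p t n a s, ?_⟩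
  rw [sum_mul_qfun, qval]
  field_simp
  ring

theorem qmin_eq_qval (h : 0 < ∑ s, P s * q22 p t n a s) : qmin p t n a P = qval p t n a P := by
  refine IsLeast.csInf_eq ⟨exists_sum_mul_qfun_eq_qval h, ?_⟩
  rintro _ ⟨x, rfl⟩
  simp only [sum_mul_qfun, qval]
  set Q₁₁ := ∑ s, P s * q11 p t n a s
  set Q₁₂ := ∑ s, P s * q12 p t n a s
  set Q₂₂ := ∑ s, P s * q22 p t n a s
  have e : Q₁₁ + 2 * Q₁₂ * x + Q₂₂ * x ^ 2 - (Q₁₁ - Q₁₂ ^ 2 / Q₂₂) =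
      Q₂₂ * (x + Q₁₂ / Q₂₂) ^ 2 := by
    field_simp
    ring
  have : 0 ≤ Q₂₂ * (x + Q₁₂ / Q₂₂) ^ 2 := by positivity
  linarith

/-- The design that weights all sequences equally. -/
def uniformDesign (p t : ℕ) : (Fin p → Fin t) → ℝ := fun _ => (Fintype.card (Fin p → Fin t) : ℝ)⁻¹

theorem uniformDesign_pos (s : Fin p → Fin t) : 0 < uniformDesign p t s := by
  have : Nonempty (Fin p → Fin t) := ⟨s⟩
  exact inv_pos.2 (by exact_mod_cast Fintype.card_pos)

theorem isDesign_uniformDesign (ht : 2 ≤ t) : IsDesign (uniformDesign p t) := by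
  have : Nonempty (Fin p → Fin t) := ⟨fun _ => ⟨0, by omega⟩⟩
  refine ⟨fun s => (uniformDesign_pos s).le, ?_⟩
  simp only [uniformDesign, Finset.sum_const, Finset.card_univ, nsmul_eq_mul]
  exact mul_inv_cancel₀ (by exact_mod_cast Fintype.card_ne_zero)

theorem isSymmetricDesign_uniformDesign (p t : ℕ) : IsSymmetricDesign (uniformDesign p t) :=
  fun _ _ => rfl

theorem exists_isGreatest_qmin (h : IsDropoutDist p a) (hn : 1 ≤ n) (hp : 2 ≤ p) (ht : 2 ≤ t) :
    ∃ P₀ : (Fin p → Fin t) → ℝ, IsDesign P₀ ∧ qval p t n a P₀ = ystar p t n a ∧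
      ∀ P : (Fin p → Fin t) → ℝ, IsDesign P → qval p t n a P ≤ ystar p t n a := by
  have hpos : ∀ P : (Fin p → Fin t) → ℝ, IsDesign P → 0 < ∑ s, P s * q22 p t n a s :=
    fun P hP => sum_mul_q22_pos h hn hp ht hP
  have hc : ContinuousOn (qval p t n a) (stdSimplex ℝ (Fin p → Fin t)) := by
    unfold qval
    refine ContinuousOn.sub (by fun_prop) (ContinuousOn.div (by fun_prop) (by fun_prop) ?_)
    exact fun P hP => (hpos P hP).ne'
  obtain ⟨P₀, hP₀, hmax⟩ := (isCompact_stdSimplex ℝ (Fin p → Fin t)).exists_isMaxOn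
    ⟨_, isDesign_uniformDesign ht⟩ hc
  have hg : IsGreatest {y : ℝ | ∃ P : (Fin p → Fin t) → ℝ, IsDesign P ∧ y = qmin p t n a P}
      (qval p t n a P₀) := by
    refine ⟨⟨P₀, hP₀, (qmin_eq_qval (hpos P₀ hP₀)).symm⟩, ?_⟩
    rintro _ ⟨P, hP, rfl⟩
    rw [qmin_eq_qval (hpos P hP)]
    exact hmax hP
  have e : ystar p t n a = qval p t n a P₀ := hg.csSup_eq
  exact ⟨P₀, hP₀, e.symm, fun P hP => e ▸ hmax hP⟩

/-- The average of a design over all relabellings of the treatments. -/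
def symmetrize (P : (Fin p → Fin t) → ℝ) : (Fin p → Fin t) → ℝ := fun s =>
  (Fintype.card (Equiv.Perm (Fin t)) : ℝ)⁻¹ * ∑ σ : Equiv.Perm (Fin t), P fun k => σ (s k)

theorem isSymmetricDesign_symmetrize (P : (Fin p → Fin t) → ℝ) :
    IsSymmetricDesign (symmetrize P) := fun σ s => by
  unfold symmetrize
  congr 1
  exact Equiv.sum_comp (Equiv.mulRight σ) fun τ => P fun k => τ (s k)

theorem sum_symmetrize_mul (P : (Fin p → Fin t) → ℝ) {f : (Fin p → Fin t) → ℝ}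
    (hf : ∀ (σ : Equiv.Perm (Fin t)) s, f (fun k => σ (s k)) = f s) :
    ∑ s, symmetrize P s * f s = ∑ s, P s * f s := by
  have e : ∀ σ : Equiv.Perm (Fin t), ∑ s : Fin p → Fin t, P (fun k => σ (s k)) * f s =
      ∑ s, P s * f s := fun σ => by
    rw [← sum_comp_perm σ fun s => P s * f s]
    simp only [hf]
  simp only [symmetrize, mul_assoc, Finset.sum_mul, ← Finset.mul_sum]
  rw [Finset.sum_comm]
  simp only [e, Finset.sum_const, Finset.card_univ, nsmul_eq_mul]
  rw [inv_mul_cancel_left₀ (by exact_mod_cast Fintype.card_ne_zero)]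

theorem IsDesign.symmetrize (hP : IsDesign P) : IsDesign (symmetrize P) := by
  refine ⟨fun s => mul_nonneg (by positivity) (Finset.sum_nonneg fun σ _ => hP.1 _), ?_⟩
  have := sum_symmetrize_mul P (f := fun _ => 1) fun _ _ => rfl
  simpa [hP.2] using this

theorem IsEquivariant.trace_comp {G H : (Fin p → Fin t) → Matrix (Fin p) (Fin t) ℝ}
    (hG : IsEquivariant G) (hH : IsEquivariant H) (A : Matrix (Fin p) (Fin p) ℝ)
    (σ : Equiv.Perm (Fin t)) (s : Fin p → Fin t) :
    (Bsq t * (G fun k => σ (s k))ᵀ * A * (H fun k => σ (s k)) * Bsq t).trace =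
      (Bsq t * (G s)ᵀ * A * H s * Bsq t).trace := by
  have e : ∀ X Y : Matrix (Fin p) (Fin t) ℝ,
      Bsq t * Xᵀ * A * Y * Bsq t = Bsq t * (Xᵀ * A * Y) * Bsq t := fun X Y => by
    simp only [Matrix.mul_assoc]
  rw [e, e, ← hG.transpose_mul_mul hH A σ s, ← trace_submatrix_perm σ,
    ← submatrix_mul_equiv _ _ _ σ,
    ← submatrix_mul_equiv _ _ _ σ, Bsq_submatrix_perm]

theorem qval_symmetrize (P : (Fin p → Fin t) → ℝ) :
    qval p t n a (symmetrize P) = qval p t n a P := by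
  unfold qval
  rw [sum_symmetrize_mul P fun σ s => isEquivariant_Tmat.trace_comp isEquivariant_Tmat _ σ s,
    sum_symmetrize_mul P fun σ s => isEquivariant_Tmat.trace_comp isEquivariant_Fmat _ σ s,
    sum_symmetrize_mul P fun σ s => isEquivariant_Fmat.trace_comp isEquivariant_Fmat _ σ s]

end

/-- Corollary 3.1(ii): if an approximate design `P` is φ₁-universally optimal,
then `C(P) = n y* B_t/(t−1)`. -/
theorem CInfo_eq_of_univOptimal
    (p t n : ℕ) (hp : 2 ≤ p) (ht : 2 ≤ t) (hn : 1 ≤ n)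
    (a : ℕ → ℝ) (ha0 : ∀ k ∈ Finset.Icc 1 p, 0 ≤ a k)
    (hsum : ∑ k ∈ Finset.Icc 1 p, a k = 1)
    (hex : ∃ k ∈ Finset.Icc 2 p, 0 < a k)
    (P : (Fin p → Fin t) → ℝ) (hP : IsDesign P)
    (hopt : IsUnivOptimal p t n a P) :
    ∀ W : Matrix (Fin t) (Fin t) ℝ, IsGInv (C22 p t n a P) W →
      CInfo p t n a P W = ((n : ℝ) * ystar p t n a / ((t : ℝ) - 1)) • Bsq t := by
  intro W hW
  have h : IsDropoutDist p a := ⟨ha0, hsum, hex⟩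
  have ht' : (0 : ℝ) < (t : ℝ) - 1 := by
    have : (2 : ℝ) ≤ t := by exact_mod_cast ht
    linarith
  have hn' : (0 : ℝ) < n := by exact_mod_cast hn
  have h12 : ∀ Q : (Fin p → Fin t) → ℝ, IsDesign Q → ∀ u : Fin t → ℝ,
      C22 p t n a Q *ᵥ u = 0 → C12 p t n a Q *ᵥ u = 0 :=
    fun Q hQ u hu => hopt.C12_mulVec_eq_zero hQ hu
  obtain ⟨P₀, hP₀, hval, hmax⟩ := exists_isGreatest_qmin (t := t) h hn hp ht
  have hU := isDesign_uniformDesign (p := p) ht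
  have hK : (elimOnes (C22 p t n a P)).PosSemidef := by
    refine posSemidef_elimOnes_C22 h hn ht h12 hU uniformDesign_pos (fun u hu1 hu => ?_) hP
    rw [dotProduct_elimOnes_C22_of_symmetric ht (isSymmetricDesign_uniformDesign p t) hu, hu1,
      mul_one]
    exact mul_pos hn' (div_pos (sum_mul_q22_pos h hn hp ht hU) ht')
  obtain ⟨x, hx⟩ := exists_sum_mul_qfun_eq_qval (sum_mul_q22_pos h hn hp ht hP)
  have hle := trace_CInfo_le h hn hP (h12 P hP) hK hW x
  rw [hx] at hle
  have hle' := hle.trans (mul_le_mul_of_nonneg_left (hmax P hP) hn'.le)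
  obtain ⟨W₀, hW₀⟩ := exists_isGInv (C22 p t n a (symmetrize P₀))
  have hge := hopt _ (isCriterion_trace_sub_symmDeviation ht) _ hP₀.symmetrize W W₀ hW hW₀
  have hS : CInfo p t n a (symmetrize P₀) W₀ =
      ((n : ℝ) * ystar p t n a / ((t : ℝ) - 1)) • Bsq t := by
    rw [CInfo_eq_of_symmetric h hn hp ht hP₀.symmetrize (isSymmetricDesign_symmetrize P₀) hW₀,
      ← hval, ← qval_symmetrize P₀, qval]
  simp only [hS, symmDeviation_smul_Bsq ht, trace_smul, trace_Bsq ht, smul_eq_mul, sub_zero,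
    div_mul_cancel₀ _ ht'.ne'] at hge
  have hdev := symmDeviation_nonneg (CInfo p t n a P W)
  have hκ := deviationBound_pos ht
  have htr : (CInfo p t n a P W).trace = n * ystar p t n a :=
    le_antisymm hle' (le_of_mul_le_mul_left (by linarith) hκ)
  rw [htr] at hge
  have := eq_of_symmDeviation_eq_zero (le_antisymm (by linarith) hdev)
  rwa [htr] at this

end
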